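/- arXiv:2008.10552 — 6 statements merged into one kernel-verified Lean document; each statement's English description precedes it below -/
import Mathlib

section
/- Let v, b, r, k be positive integers with r > 2 and s := v/k an integer with s > 1, and let Δ be an affine resolvable (v,b,r,k)-design. Then the eigenvalues of the scaled information matrix F(Δ), counted with multiplicity, are: 0 with multiplicity 1, 1 − 1/r with multiplicity r(s−1), and 1 with multiplicity v − 1 − r(s−1); equivalently, the canonical efficiency factors of Δ are 1 − 1/r with multiplicity r(s−1) and 1 with multiplicity v − 1 − r(s−1). -/
open Polynomial

/-- A `(v,b,r,k)`-design: `b` blocks (indexed by `Fin b`, so repeated blocks are allowed),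
each a `k`-subset of the `v` treatments, with each treatment in exactly `r` blocks. -/
structure BlockDesign (v b r k : ℕ) where
  blocks : Fin b → Finset (Fin v)
  blockSize : ∀ j, (blocks j).card = k
  replication : ∀ α : Fin v, (Finset.univ.filter fun j => α ∈ blocks j).card = r

namespace BlockDesign

variable {v b r k : ℕ}

/-- The concurrence of two treatments: the number of blocks containing both. -/
def concurrence (D : BlockDesign v b r k) (α β : Fin v) : ℕ :=
  (Finset.univ.filter fun j => α ∈ D.blocks j ∧ β ∈ D.blocks j).card

/-- The scaled information matrix `F(Δ) = I − (rk)⁻¹ Λ`. -/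
noncomputable def infoMatrix (D : BlockDesign v b r k) : Matrix (Fin v) (Fin v) ℝ :=
  1 - ((r : ℝ) * (k : ℝ))⁻¹ • Matrix.of (fun α β => (D.concurrence α β : ℝ))

/-- `η_i(Δ)`: the number of unordered pairs of distinct treatments with concurrence `i`. -/
def eta (D : BlockDesign v b r k) (i : ℕ) : ℕ :=
  (Finset.univ.filter fun p : Fin v × Fin v => p.1 < p.2 ∧ D.concurrence p.1 p.2 = i).card

/-- `π : Fin b → Fin r` assigns blocks to parallel classes, each class partitioning
the treatment set. -/
def IsResolution (D : BlockDesign v b r k) (π : Fin b → Fin r) : Prop :=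
  ∀ (c : Fin r) (α : Fin v), ∃! j : Fin b, π j = c ∧ α ∈ D.blocks j

def IsResolvable (D : BlockDesign v b r k) : Prop :=
  k < v ∧ 1 < r ∧ ∃ π : Fin b → Fin r, D.IsResolution π

def IsAffineResolvable (D : BlockDesign v b r k) : Prop :=
  k < v ∧ 1 < r ∧ ∃ π : Fin b → Fin r, D.IsResolution π ∧
    ∃ μ : ℕ, 0 < μ ∧ ∀ j j' : Fin b, π j ≠ π j' → (D.blocks j ∩ D.blocks j').card = μ

/-- The canonical efficiency factors, as a multiset: the eigenvalues (with multiplicity,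
i.e. the roots of the characteristic polynomial) of the scaled information matrix,
with one copy of the eigenvalue `0` removed. -/
noncomputable def effFactors (D : BlockDesign v b r k) : Multiset ℝ :=
  (D.infoMatrix.charpoly.roots).erase 0

/-- The canonical efficiency factors, sorted increasingly. -/
noncomputable def sortedEff (D : BlockDesign v b r k) : List ℝ :=
  D.effFactors.sort (· ≤ ·)

/-- `D` is Schur optimal in a class `C` of `(v,b,r,k)`-designs. -/
def SchurOptimalIn (D : BlockDesign v b r k) (C : Set (BlockDesign v b r k)) : Prop :=
  D ∈ C ∧ ∀ Γ ∈ C, ∀ ℓ : ℕ, 1 ≤ ℓ → ℓ ≤ v - 1 →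
    ((Γ.sortedEff).take ℓ).sum ≤ ((D.sortedEff).take ℓ).sum

/-- `D` is an `s`-fold inflation of `E`. -/
def IsInflation (s : ℕ) {w m : ℕ} (D : BlockDesign v b r k) (E : BlockDesign w b r m) : Prop :=
  ∃ e : Fin v ≃ Fin w × Fin s, ∀ (α : Fin v) (j : Fin b), α ∈ D.blocks j ↔ (e α).1 ∈ E.blocks j

/-- `D` is a `(v,b,r,k,λ)`-balanced incomplete-block design. -/
def IsBIBD (D : BlockDesign v b r k) (lam : ℕ) : Prop :=
  1 < k ∧ k < v ∧ ∀ α β : Fin v, α ≠ β → D.concurrence α β = lam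

end BlockDesign

/-- An `(n×n)/k` semi-Latin square. -/
structure SemiLatinSquare (n k : ℕ) where
  block : Fin n → Fin n → Finset (Fin (n * k))
  blockSize : ∀ i j, (block i j).card = k
  row_once : ∀ (i : Fin n) (α : Fin (n * k)), ∃! j : Fin n, α ∈ block i j
  col_once : ∀ (j : Fin n) (α : Fin (n * k)), ∃! i : Fin n, α ∈ block i j

namespace SemiLatinSquare

variable {n k : ℕ}

/-- `S` is uniform with intersection parameter `μ`. -/
def UniformWith (S : SemiLatinSquare n k) (μ : ℕ) : Prop :=
  0 < μ ∧ ∀ i j i' j' : Fin n, i ≠ i' → j ≠ j' →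
    (S.block i j ∩ S.block i' j').card = μ

def IsUniform (S : SemiLatinSquare n k) : Prop := ∃ μ : ℕ, S.UniformWith μ

/-- Concurrence in the underlying block design of `S`. -/
def concurrence (S : SemiLatinSquare n k) (α β : Fin (n * k)) : ℕ :=
  (Finset.univ.filter fun p : Fin n × Fin n =>
    α ∈ S.block p.1 p.2 ∧ β ∈ S.block p.1 p.2).card

/-- The scaled information matrix of the underlying block design of `S`
(which is an `(nk, n², n, k)`-design, so `rk = nk`). -/
noncomputable def infoMatrix (S : SemiLatinSquare n k) :
    Matrix (Fin (n * k)) (Fin (n * k)) ℝ :=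
  1 - ((n : ℝ) * (k : ℝ))⁻¹ • Matrix.of (fun α β => (S.concurrence α β : ℝ))

/-- `η_i(S)`: the number of unordered pairs of distinct treatments with concurrence `i`. -/
def eta (S : SemiLatinSquare n k) (i : ℕ) : ℕ :=
  (Finset.univ.filter fun p : Fin (n * k) × Fin (n * k) =>
    p.1 < p.2 ∧ S.concurrence p.1 p.2 = i).card

/-- Canonical efficiency factors of `S` (eigenvalues of the scaled information matrix,
with multiplicity, after removing one copy of `0`). -/
noncomputable def effFactors (S : SemiLatinSquare n k) : Multiset ℝ :=
  (S.infoMatrix.charpoly.roots).erase 0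

noncomputable def sortedEff (S : SemiLatinSquare n k) : List ℝ :=
  S.effFactors.sort (· ≤ ·)

/-- `S` is Schur optimal in the class of all `(n×n)/k` semi-Latin squares
(on the same treatment set). -/
def SchurOptimal (S : SemiLatinSquare n k) : Prop :=
  ∀ T : SemiLatinSquare n k, ∀ ℓ : ℕ, 1 ≤ ℓ → ℓ ≤ n * k - 1 →
    ((T.sortedEff).take ℓ).sum ≤ ((S.sortedEff).take ℓ).sum

/-- `S` is an `s`-fold inflation of `T`. -/
def IsInflation (s : ℕ) (S : SemiLatinSquare n (s * k)) (T : SemiLatinSquare n k) : Prop :=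
  ∃ e : Fin (n * (s * k)) ≃ Fin (n * k) × Fin s,
    ∀ (α : Fin (n * (s * k))) (i j : Fin n), α ∈ S.block i j ↔ (e α).1 ∈ T.block i j

/-- The PV-aberration vector `(η₀(S), …, η_n(S))`. -/
def etaVec (S : SemiLatinSquare n k) : List ℕ :=
  (List.range (n + 1)).map (S.eta)

/-- `S` has minimum PV aberration in the class of uniform `(n×n)/k` semi-Latin squares:
no uniform square has a lexicographically smaller `η`-vector. -/
def MinPVAberration (S : SemiLatinSquare n k) : Prop :=
  ∀ T : SemiLatinSquare n k, T.IsUniform → ¬ List.Lex (· < ·) (T.etaVec) (S.etaVec)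

end SemiLatinSquare

/-- `L` is a Latin square of order `n` (symbols `Fin n`). -/
def IsLatin (n : ℕ) (L : Fin n → Fin n → Fin n) : Prop :=
  (∀ (i a : Fin n), ∃! j : Fin n, L i j = a) ∧ (∀ (j a : Fin n), ∃! i : Fin n, L i j = a)

/-- Two Latin squares of order `n` are orthogonal: each pair of symbols occurs together
in exactly one cell of the superposition. -/
def AreOrthogonal {n : ℕ} (L M : Fin n → Fin n → Fin n) : Prop :=
  ∀ a b : Fin n, ∃! p : Fin n × Fin n, L p.1 p.2 = a ∧ M p.1 p.2 = b

/-- A family of mutually orthogonal Latin squares of order `n`. -/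
def IsMOLS {n m : ℕ} (L : Fin m → Fin n → Fin n → Fin n) : Prop :=
  (∀ t, IsLatin n (L t)) ∧ ∀ t t', t ≠ t' → AreOrthogonal (L t) (L t')

/-- `S` is a `μ`-fold inflation of a superposition of `n−1` mutually orthogonal
Latin squares of order `n` (with pairwise disjoint symbol sets): the treatments of `S`
are identified with triples `((t, a), c)` where `t` indexes the Latin square, `a` is a
symbol, and `c` is the inflation index, and treatment `((t,a),c)` lies in block `(i,j)`
iff Latin square `t` has symbol `a` in cell `(i,j)`. -/
def SemiLatinSquare.IsInflatedMOLSSuperposition {n k : ℕ} (μ : ℕ)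
    (S : SemiLatinSquare n k) : Prop :=
  ∃ L : Fin (n - 1) → Fin n → Fin n → Fin n, IsMOLS L ∧
    ∃ e : Fin (n * k) ≃ (Fin (n - 1) × Fin n) × Fin μ,
      ∀ (α : Fin (n * k)) (i j : Fin n),
        α ∈ S.block i j ↔ L (e α).1.1 i j = (e α).1.2


theorem aux_multiset (a : ℝ) (M : Multiset ℝ) (h : ∀ x ∈ M, x = 0 ∨ x = a ∨ x = 1) :
    ∃ c0 c1 c2 : ℕ, M = Multiset.replicate c0 (0 : ℝ) + Multiset.replicate c1 a +
      Multiset.replicate c2 1 := by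
  induction M using Multiset.induction_on with
  | empty => exact ⟨0, 0, 0, by simp⟩
  | cons x M ih =>
    obtain ⟨c0, c1, c2, hM⟩ := ih (fun y hy => h y (Multiset.mem_cons_of_mem hy))
    rcases h x (Multiset.mem_cons_self x M) with rfl | rfl | rfl
    · exact ⟨c0 + 1, c1, c2, by rw [hM]; simp [Multiset.replicate_succ]⟩
    · exact ⟨c0, c1 + 1, c2, by rw [hM]; simp [Multiset.replicate_succ]⟩
    · exact ⟨c0, c1, c2 + 1, by rw [hM]; simp [Multiset.replicate_succ]⟩

theorem aux_spec {n : ℕ} (F : Matrix (Fin n) (Fin n) ℝ) (hF : F.IsHermitian) (a : ℝ)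
    (h3 : F * ((F - 1) * (F - a • 1)) = 0) :
    (∀ i, hF.eigenvalues i = 0 ∨ hF.eigenvalues i = a ∨ hF.eigenvalues i = 1) ∧
    ((F - 1) * (F - a • 1)).trace =
      ∑ i, (hF.eigenvalues i - 1) * (hF.eigenvalues i - a) := by
  have hs := hF.spectral_theorem
  set U : Matrix.unitaryGroup (Fin n) ℝ := hF.eigenvectorUnitary
  set d := hF.eigenvalues
  have hd : (RCLike.ofReal ∘ d : Fin n → ℝ) = d := by ext i; simp
  rw [hd] at hs
  have h1 : (F - 1) * (F - a • 1) = Unitary.conjStarAlgAut ℝ _ U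
      ((Matrix.diagonal d - 1) * (Matrix.diagonal d - a • 1)) := by
    rw [map_mul, map_sub, map_sub, map_smul, map_one, ← hs]
  have hdd : (Matrix.diagonal d - 1) * (Matrix.diagonal d - a • 1) =
      Matrix.diagonal (fun i => (d i - 1) * (d i - a)) := by
    have e1 : (1 : Matrix (Fin n) (Fin n) ℝ) = Matrix.diagonal (fun _ => 1) := by simp
    have e2 : (a • 1 : Matrix (Fin n) (Fin n) ℝ) = Matrix.diagonal (fun _ => a) := by
      rw [← Matrix.diagonal_one, ← Matrix.diagonal_smul]; congr 1; ext; simp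
    rw [e2, e1, Matrix.diagonal_sub, Matrix.diagonal_sub, Matrix.diagonal_mul_diagonal]
  constructor
  · intro i
    rw [h1, hs, ← map_mul, hdd, Matrix.diagonal_mul_diagonal] at h3
    have h4 := (map_eq_zero_iff _ (Unitary.conjStarAlgAut ℝ _ U).injective).1 h3
    have h5 := congrFun (congrFun h4 i) i
    simp only [Matrix.diagonal_apply_eq, Matrix.zero_apply, mul_eq_zero, sub_eq_zero] at h5
    tauto
  · rw [h1, hdd, Unitary.conjStarAlgAut_apply, Matrix.trace_mul_comm, ← mul_assoc]
    simp [Matrix.trace_diagonal]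

theorem aux_final {n : ℕ} (F : Matrix (Fin n) (Fin n) ℝ) (hF : F.IsHermitian) (r s : ℕ)
    (hr : 2 < r) (hs : 1 < s)
    (h3 : F * ((F - 1) * (F - (1 - 1 / (r : ℝ)) • 1)) = 0)
    (ht : F.trace = n - s)
    (ht2 : ((F - 1) * (F - (1 - 1 / (r : ℝ)) • 1)).trace = 1 - 1 / (r : ℝ)) :
    F.charpoly.roots =
      Multiset.replicate 1 (0 : ℝ) +
      Multiset.replicate (r * (s - 1)) (1 - 1 / (r : ℝ)) +
      Multiset.replicate (n - 1 - r * (s - 1)) 1 := by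
  obtain ⟨h1, h2⟩ := aux_spec F hF _ h3
  have hrR : (2 : ℝ) < r := by exact_mod_cast hr
  have hM : F.charpoly.roots = Multiset.map hF.eigenvalues Finset.univ.val := by
    rw [hF.roots_charpoly_eq_eigenvalues]; rfl
  obtain ⟨c0, c1, c2, hc⟩ := aux_multiset (1 - 1 / (r : ℝ))
    (Multiset.map hF.eigenvalues Finset.univ.val) (by
      intro x hx
      obtain ⟨i, -, rfl⟩ := Multiset.mem_map.1 hx
      exact h1 i)
  have k1 := congrArg Multiset.card hc
  have k2 := congrArg Multiset.sum hc
  have k3 := congrArg (fun M => (Multiset.map (fun x => (x - 1) * (x - (1 - 1 / (r : ℝ)))) M).sum) hc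
  have ht' := hF.trace_eq_sum_eigenvalues
  rw [ht] at ht'
  rw [ht2] at h2
  simp only [Multiset.map_map, Multiset.map_add, Multiset.map_replicate, Multiset.sum_add,
    Multiset.sum_replicate] at k3
  simp only [Multiset.sum_add, Multiset.sum_replicate] at k2
  change ∑ i, (hF.eigenvalues i - 1) * (hF.eigenvalues i - (1 - 1 / (r : ℝ))) = _ at k3
  change ∑ i, hF.eigenvalues i = _ at k2
  rw [← h2] at k3
  have ht'' : (n : ℝ) - s = ∑ i, hF.eigenvalues i := by simpa using ht'
  rw [← ht''] at k2
  simp at k1 k2 k3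
  have k1R : (n : ℝ) = c0 + c1 + c2 := by rw [k1]; push_cast; ring
  have ha : (1 - (r : ℝ)⁻¹) ≠ 0 := by
    have : (r : ℝ)⁻¹ < 1 := inv_lt_one_of_one_lt₀ (by linarith)
    linarith
  have hc0 : (c0 : ℝ) = 1 := by
    have : ((c0 : ℝ) - 1) * (1 - (r : ℝ)⁻¹) = 0 := by linarith
    rcases mul_eq_zero.1 this with h | h
    · linarith
    · exact absurd h ha
  have hc1 : (c1 : ℝ) = r * (s - 1) := by
    have hri : (r : ℝ) * (r : ℝ)⁻¹ = 1 := mul_inv_cancel₀ (by linarith)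
    have : (c1 : ℝ) * (r : ℝ)⁻¹ = s - 1 := by linarith
    calc (c1 : ℝ) = r * (c1 * (r : ℝ)⁻¹) := by linear_combination (-(c1:ℝ)) * hri
      _ = _ := by rw [this]
  have hc0' : c0 = 1 := by exact_mod_cast hc0
  have hc1' : c1 = r * (s - 1) := by
    have : ((r * (s - 1) : ℕ) : ℝ) = r * (s - 1) := by
      rw [Nat.cast_mul, Nat.cast_sub hs.le]; simp
    rw [← this] at hc1
    exact_mod_cast hc1
  have hc2' : c2 = n - 1 - r * (s - 1) := by rw [← hc1']; omega
  rw [hM, hc, ← hc2', ← hc1', hc0']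

theorem aux_design (v b r k s : ℕ) (hv : 0 < v)
    (hk : 0 < k) (hr : 2 < r) (hvs : v = k * s)
    (D : BlockDesign v b r k) (hD : D.IsAffineResolvable) :
    ∃ c : ℝ, let Q := ((r : ℝ) * (k : ℝ))⁻¹ • Matrix.of (fun α β => (D.concurrence α β : ℝ))
      let J : Matrix (Fin v) (Fin v) ℝ := Matrix.of fun _ _ => 1
      Q.IsHermitian ∧ Q * J = J ∧ Q * Q = (r : ℝ)⁻¹ • Q + c • J ∧ Q.trace = s := by
  classical
  obtain ⟨-, -, π, hπ, μ, -, hμ⟩ := hD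
  have hrR : (r : ℝ) ≠ 0 := by positivity
  have hkR : (k : ℝ) ≠ 0 := by positivity
  let N : Fin v → Fin b → ℝ := fun α j => if α ∈ D.blocks j then 1 else 0
  have hN1 : ∀ α, ∑ j, N α j = r := fun α => by
    simp [N, ← D.replication α]
  have hN2 : ∀ j, ∑ α, N α j = k := fun j => by
    simp [N, ← D.blockSize j]
  have hNπ : ∀ c α, ∑ j, (if π j = c then N α j else 0) = 1 := fun c α => by
    obtain ⟨j, ⟨h1, h2⟩, h3⟩ := hπ c α
    rw [Finset.sum_eq_single j]
    · simp [N, h1, h2]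
    · intro j' _ hj'
      by_contra hne
      apply hj'
      apply h3
      by_contra hcon
      apply hne
      simp only [N]
      split_ifs <;> tauto
    · simp
  have hL : ∀ α β, (D.concurrence α β : ℝ) = ∑ j, N α j * N β j := fun α β => by
    rw [BlockDesign.concurrence, Finset.card_filter]
    push_cast
    refine Finset.sum_congr rfl fun j _ => ?_
    simp only [N]
    split_ifs <;> simp_all
  have hG : ∀ j j', ∑ α, N α j * N α j' =
      (if j = j' then (k : ℝ) else 0) + μ - (if π j' = π j then (μ : ℝ) else 0) := fun j j' => by
    have e : ∑ α, N α j * N α j' = ((D.blocks j ∩ D.blocks j').card : ℝ) := by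
      have : D.blocks j ∩ D.blocks j' =
          Finset.univ.filter (fun α => α ∈ D.blocks j ∧ α ∈ D.blocks j') := by ext; simp
      rw [this, Finset.card_filter]
      push_cast
      refine Finset.sum_congr rfl fun α _ => ?_
      simp only [N]
      split_ifs <;> simp_all
    rw [e]
    by_cases hj : j = j'
    · subst hj; simp [D.blockSize]
    · by_cases hp : π j' = π j
      · have : D.blocks j ∩ D.blocks j' = ∅ := by
          ext α
          simp only [Finset.mem_inter, Finset.notMem_empty, iff_false, not_and]
          intro h1 h2
          exact hj ((hπ (π j) α).unique ⟨rfl, h1⟩ ⟨hp, h2⟩)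
        simp [this, hj, hp]
      · simp [hj, hp, hμ j j' (Ne.symm hp)]
  have hLL : ∀ α β, ∑ γ, (D.concurrence α γ : ℝ) * (D.concurrence γ β : ℝ) =
      k * D.concurrence α β + μ * (r * r - r) := fun α β => by
    calc ∑ γ, (D.concurrence α γ : ℝ) * (D.concurrence γ β : ℝ)
        = ∑ γ, ∑ j, ∑ j', N α j * N β j' * (N γ j * N γ j') := by
          refine Finset.sum_congr rfl fun γ _ => ?_
          rw [hL, hL, Finset.sum_mul_sum]
          refine Finset.sum_congr rfl fun j _ => Finset.sum_congr rfl fun j' _ => ?_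
          ring
      _ = ∑ j, ∑ j', N α j * N β j' * ∑ γ, (N γ j * N γ j') := by
          rw [Finset.sum_comm]
          refine Finset.sum_congr rfl fun j _ => ?_
          rw [Finset.sum_comm]
          refine Finset.sum_congr rfl fun j' _ => ?_
          rw [Finset.mul_sum]
      _ = ∑ j, (k * (N α j * N β j) + μ * (N α j * ∑ j', N β j')
            - μ * (N α j * ∑ j', (if π j' = π j then N β j' else 0))) := by
          refine Finset.sum_congr rfl fun j _ => ?_
          have e1 : k * (N α j * N β j) =
              ∑ j', N α j * N β j' * (if j = j' then (k : ℝ) else 0) := by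
            simp; ring
          rw [e1, Finset.mul_sum, Finset.mul_sum, Finset.mul_sum, Finset.mul_sum,
            ← Finset.sum_add_distrib, ← Finset.sum_sub_distrib]
          refine Finset.sum_congr rfl fun j' _ => ?_
          rw [hG]
          split_ifs <;> ring
      _ = _ := by
          simp only [hN1, hNπ, Finset.sum_sub_distrib, Finset.sum_add_distrib, ← Finset.mul_sum,
            ← Finset.sum_mul, ← hL]
          ring
  refine ⟨((r : ℝ) * (k : ℝ))⁻¹ ^ 2 * (μ * (r * r - r)), ?_, ?_, ?_, ?_⟩
  · ext α β
    simp [hL, mul_comm]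
  · ext α β
    simp only [Matrix.smul_apply, Matrix.mul_apply, Matrix.of_apply, mul_one,
      smul_eq_mul]
    have : ∑ γ, (D.concurrence α γ : ℝ) = r * k := by
      simp only [hL]
      rw [Finset.sum_comm]
      simp only [← Finset.mul_sum, hN2, ← Finset.sum_mul, hN1]
    rw [← Finset.mul_sum, this]
    exact inv_mul_cancel₀ (mul_ne_zero hrR hkR)
  · ext α β
    simp only [Matrix.smul_apply, Matrix.mul_apply,
      Matrix.add_apply, Matrix.of_apply, mul_one, smul_eq_mul]
    simp only [mul_mul_mul_comm, ← Finset.mul_sum]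
    rw [hLL]
    field_simp
  · have : ∀ α, (D.concurrence α α : ℝ) = r := fun α => by
      simp [BlockDesign.concurrence, D.replication]
    simp only [Matrix.trace, Matrix.diag, Matrix.smul_apply, Matrix.of_apply, this, smul_eq_mul,
      Finset.sum_const, Finset.card_univ, Fintype.card_fin, nsmul_eq_mul, hvs]
    push_cast
    field_simp

/-- Theorem 1(1) (Bose–Morgan–Mukhopadhyay): the eigenvalues, with multiplicity, of the
scaled information matrix of an affine resolvable `(v,b,r,k)`-design with `r > 2` and
`s = v/k > 1` are `0` (once), `1 − 1/r` (with multiplicity `r(s−1)`) and `1`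
(with multiplicity `v − 1 − r(s−1)`). -/
theorem affine_resolvable_eigenvalues (v b r k s : ℕ) (hv : 0 < v) (hb : 0 < b)
    (hk : 0 < k) (hr : 2 < r) (hs : 1 < s) (hvs : v = k * s)
    (D : BlockDesign v b r k) (hD : D.IsAffineResolvable) :
    D.infoMatrix.charpoly.roots =
      Multiset.replicate 1 (0 : ℝ) +
      Multiset.replicate (r * (s - 1)) (1 - 1 / (r : ℝ)) +
      Multiset.replicate (v - 1 - r * (s - 1)) 1 := by
  obtain ⟨c, hQ, hQJ, hQQ, hQt⟩ := aux_design v b r k s hv hk hr hvs D hD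
  have hF : D.infoMatrix = 1 - ((r : ℝ) * (k : ℝ))⁻¹ •
    Matrix.of (fun α β => (D.concurrence α β : ℝ)) := rfl
  rw [hF]
  generalize ((r : ℝ) * (k : ℝ))⁻¹ • Matrix.of (fun α β => (D.concurrence α β : ℝ)) = Q at *
  generalize hJ : (Matrix.of fun _ _ => 1 : Matrix (Fin v) (Fin v) ℝ) = J at *
  have hJne : J ≠ 0 := by
    intro h
    have := congrFun (congrFun h ⟨0, hv⟩) ⟨0, hv⟩
    rw [← hJ] at this
    simp at this
  have hJJ : J * J = (v : ℝ) • J := by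
    rw [← hJ]; ext i j; simp [Matrix.mul_apply]
  have hJt : J.trace = v := by
    rw [← hJ]; simp [Matrix.trace]
  have hcv : c * v = 1 - 1 / (r : ℝ) := by
    have h1 : Q * Q * J = J := by rw [mul_assoc, hQJ, hQJ]
    rw [hQQ, add_mul, Matrix.smul_mul, Matrix.smul_mul, hQJ, hJJ, smul_smul, ← add_smul] at h1
    have h2 : ((r : ℝ)⁻¹ + c * v - 1) • J = 0 := by rw [sub_smul, h1, one_smul, sub_self]
    rcases smul_eq_zero.1 h2 with h | h
    · rw [one_div]; linarith
    · exact absurd h hJne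
  have hprod : (1 - Q - 1) * (1 - Q - (1 - 1 / (r : ℝ)) • 1) = c • J := by
    have e1 : (1 - Q - 1) = -Q := by abel
    have e2 : (1 - Q - (1 - 1 / (r : ℝ)) • (1 : Matrix (Fin v) (Fin v) ℝ)) =
        (r : ℝ)⁻¹ • 1 - Q := by
      rw [sub_smul, one_smul, one_div]; abel
    rw [e1, e2, mul_sub, neg_mul, neg_mul, hQQ, Matrix.mul_smul, mul_one]
    abel
  apply aux_final (1 - Q) (Matrix.isHermitian_one.sub hQ) r s hr hs
  · rw [hprod, Matrix.mul_smul, sub_mul, one_mul, hQJ, sub_self, smul_zero]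
  · rw [Matrix.trace_sub, hQt]; simp
  · rw [hprod, Matrix.trace_smul, hJt, smul_eq_mul, hcv]
end

section
/- Let v, b, r, k be positive integers with r > 2 and s := v/k an integer with s > 1, and suppose there exists an affine resolvable (v,b,r,k)-design. Then a resolvable (v,b,r,k)-design is Schur optimal in the class of all resolvable (v,b,r,k)-designs if and only if it is affine resolvable. -/
open Polynomial

theorem aux_drop_bound (a : ℝ) (ha : a ≤ 1) (M : List ℝ) (h : ∀ x ∈ M, a ≤ x) :
    (M.length : ℝ) - (M.countP (fun x => decide (x ≠ 1)) : ℝ) * (1 - a) ≤ M.sum := by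
  induction M with
  | nil => simp
  | cons x M ih =>
    have h1 := ih (fun y hy => h y (List.mem_cons_of_mem _ hy))
    have h2 := h x (List.mem_cons_self)
    rw [List.countP_cons, List.sum_cons, List.length_cons]
    by_cases hx : x = 1
    · subst hx
      simp at h1 ⊢
      linarith
    · simp [hx] at h1 ⊢
      nlinarith

theorem aux_upper (L : List ℝ) (hL : L.Pairwise (· ≤ ·)) (h1 : ∀ x ∈ L, x ≤ 1) (r s : ℕ)
    (hr : 0 < r) (hs : 1 < s)
    (hsum : L.sum = L.length - ((s : ℝ) - 1))
    (hc : L.countP (fun x => decide (x ≠ 1)) ≤ r * (s - 1)) (l : ℕ) (hl : l ≤ L.length) :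
    (L.take l).sum ≤ l - ((s : ℝ) - 1) ∨ (L.take l).sum ≤ l - (l : ℝ) / r := by
  have hsplit : (L.take l).sum + (L.drop l).sum = L.sum := List.sum_take_add_sum_drop L l
  have hlen : (L.drop l).length = L.length - l := List.length_drop
  have hlenR : ((L.drop l).length : ℝ) = L.length - l := by
    rw [hlen, Nat.cast_sub hl]
  rcases Nat.lt_or_ge l L.length with hlt | hge
  · set a := L[l]
    have hdrop : ∀ x ∈ L.drop l, a ≤ x := by
      have hp : (L.drop l).Pairwise (· ≤ ·) := hL.sublist (List.drop_sublist _ _)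
      rw [List.drop_eq_getElem_cons hlt] at hp ⊢
      intro x hx
      rcases List.mem_cons.1 hx with h | h
      · exact h ▸ le_refl _
      · exact (List.pairwise_cons.1 hp).1 x h
    have htake : ∀ x ∈ L.take l, x ≤ a := by
      intro x hx
      have := hL
      rw [← List.take_append_drop l L, List.pairwise_append] at this
      refine this.2.2 x hx a ?_
      rw [List.drop_eq_getElem_cons hlt]; exact List.mem_cons_self
    have ha1 : a ≤ 1 := h1 a (List.getElem_mem hlt)
    have hb := aux_drop_bound a ha1 _ hdrop
    have hT : (L.take l).sum ≤ l * a := by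
      have := List.sum_le_card_nsmul (L.take l) a htake
      simpa [List.length_take, min_eq_left hl] using this
    rcases ha1.lt_or_eq with halt | haeq
    · right
      have hcnt : (L.drop l).countP (fun x => decide (x ≠ 1)) + l ≤ r * (s - 1) := by
        have e : L.countP (fun x => decide (x ≠ 1)) =
            (L.take l).countP (fun x => decide (x ≠ 1)) +
            (L.drop l).countP (fun x => decide (x ≠ 1)) := by
          rw [← List.countP_append, List.take_append_drop]
        have e2 : (L.take l).countP (fun x => decide (x ≠ 1)) = l := by
          have : (L.take l).countP (fun x => decide (x ≠ 1)) = (L.take l).length := by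
            rw [List.countP_eq_length]
            intro x hx
            have := htake x hx
            simp
            linarith
          rw [this, List.length_take, min_eq_left hl]
        omega
      have hcR : ((L.drop l).countP (fun x => decide (x ≠ 1)) : ℝ) + l ≤ r * ((s : ℝ) - 1) := by
        have : (((L.drop l).countP (fun x => decide (x ≠ 1)) + l : ℕ) : ℝ) ≤
          ((r * (s - 1) : ℕ) : ℝ) := by exact_mod_cast hcnt
        rw [Nat.cast_mul, Nat.cast_sub hs.le] at this
        simpa using this
      generalize ((L.drop l).countP (fun x => decide (x ≠ 1)) : ℝ) = j at *
      have hrR : (0 : ℝ) < r := by exact_mod_cast hr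
      have hsR : (1 : ℝ) < s := by exact_mod_cast hs
      set S := (L.take l).sum
      have k1 : (s : ℝ) - 1 - j * (1 - a) ≤ l - S := by linarith
      have k2 : j * (1 - a) ≤ (r * ((s : ℝ) - 1) - l) * (1 - a) :=
        mul_le_mul_of_nonneg_right (by linarith) (by linarith)
      have hl0 : (0 : ℝ) ≤ l := Nat.cast_nonneg _
      have hj0 : (0:ℝ) ≤ r * ((s : ℝ) - 1) - l := by
        have : ((L.drop l).countP (fun x => decide (x ≠ 1)) + l : ℕ) ≤ r * (s-1) := hcnt
        have : ((l : ℕ) : ℝ) ≤ ((r * (s - 1) : ℕ) : ℝ) := by exact_mod_cast (by omega)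
        rw [Nat.cast_mul, Nat.cast_sub hs.le] at this
        simp at this
        linarith
      have k3 : (r * ((s : ℝ) - 1) - l) * (l * (1 - a)) ≤ (r * ((s : ℝ) - 1) - l) * (l - S) :=
        mul_le_mul_of_nonneg_left (by linarith) hj0
      have k4 : (l : ℝ) * ((s : ℝ) - 1 - (r * ((s : ℝ) - 1) - l) * (1 - a)) ≤ l * (l - S) :=
        mul_le_mul_of_nonneg_left (by linarith) hl0
      have k5 : ((s : ℝ) - 1) * l ≤ ((s : ℝ) - 1) * (r * (l - S)) := by nlinarith
      have k6 : (l : ℝ) ≤ r * (l - S) := le_of_mul_le_mul_left k5 (by linarith)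
      have : (l : ℝ) / r ≤ l - S := by rw [div_le_iff₀ hrR]; linarith
      linarith
    · left
      rw [haeq] at hb
      linarith
  · left
    have : l = L.length := le_antisymm hl hge
    rw [this, List.take_length]
    exact hsum.le

theorem aux_lower (L : List ℝ) (h1 : ∀ x ∈ L, x ≤ 1) (r s : ℕ)
    (h2 : ∀ x ∈ L, 1 - 1 / (r : ℝ) ≤ x)
    (hsum : L.sum = L.length - ((s : ℝ) - 1)) (l : ℕ) (hl : l ≤ L.length) :
    l - ((s : ℝ) - 1) ≤ (L.take l).sum ∧ l - (l : ℝ) / r ≤ (L.take l).sum := by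
  have hsplit : (L.take l).sum + (L.drop l).sum = L.sum := List.sum_take_add_sum_drop L l
  have hlen : (L.drop l).length = L.length - l := List.length_drop
  have hlenR : ((L.drop l).length : ℝ) = L.length - l := by
    rw [hlen, Nat.cast_sub hl]
  constructor
  · have := List.sum_le_card_nsmul (L.drop l) 1 (fun x hx => h1 x (List.mem_of_mem_drop hx))
    rw [nsmul_eq_mul, hlenR] at this
    linarith
  · have := List.card_nsmul_le_sum (L.take l) (1 - 1 / (r : ℝ))
      (fun x hx => h2 x (List.mem_of_mem_take hx))
    rw [nsmul_eq_mul, List.length_take, min_eq_left hl] at this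
    have e : (l : ℝ) / r = l * (1 / r) := by ring
    linarith

section Aux

open scoped Matrix

theorem aux_roots {v : ℕ} (hv : 0 < v) (F : Matrix (Fin v) (Fin v) ℝ)
    (hF : F *ᵥ (fun _ => (1 : ℝ)) = 0) :
    F.charpoly.roots + {1} =
      (F + Matrix.vecMulVec (fun _ => (1 : ℝ)) (fun _ => (v : ℝ)⁻¹)).charpoly.roots + {0} := by
  set J := Matrix.vecMulVec (fun _ : Fin v => (1 : ℝ)) (fun _ : Fin v => (v : ℝ)⁻¹) with hJ
  have hFJ : F * J = 0 := by
    rw [hJ, Matrix.mul_vecMulVec, hF]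
    ext; simp [Matrix.vecMulVec]
  have hvR : (v : ℝ) ≠ 0 := by exact_mod_cast hv.ne'
  have hJc : J.charpoly = X ^ (v - 1) * (X - C 1) := by
    rw [hJ, Matrix.charpoly_vecMulVec]
    obtain ⟨w, rfl⟩ : ∃ w, v = w + 1 := ⟨v - 1, by omega⟩
    simp only [dotProduct, one_mul, Finset.sum_const, Finset.card_univ, Fintype.card_fin,
      nsmul_eq_mul, mul_inv_cancel₀ hvR, one_smul, Nat.add_sub_cancel, map_one]
    ring
  have hmul : F.charmatrix * J.charmatrix = (X : ℝ[X]) • (F + J).charmatrix := by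
    have e1 : ∀ M : Matrix (Fin v) (Fin v) ℝ, M.charmatrix =
        (X : ℝ[X]) • (1 : Matrix (Fin v) (Fin v) ℝ[X]) - M.map C := by
      intro M
      rw [Matrix.charmatrix, Matrix.smul_one_eq_diagonal]
      rfl
    have e2 : F.map C * J.map C = (0 : Matrix (Fin v) (Fin v) ℝ[X]) := by
      rw [← Matrix.map_mul, hFJ]; ext; simp
    have e3 : (F + J).map C = F.map C + J.map (C : ℝ →+* ℝ[X]) := by
      ext; simp
    rw [e1, e1, e1, e3]
    simp only [sub_mul, mul_sub, e2, smul_mul_assoc, mul_smul_comm, one_mul, mul_one, smul_sub,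
      smul_add]
    abel
  have hdet := congrArg Matrix.det hmul
  rw [Matrix.det_mul, Matrix.det_smul, Fintype.card_fin] at hdet
  change F.charpoly * J.charpoly = X ^ v * (F + J).charpoly at hdet
  rw [hJc] at hdet
  have hfin : F.charpoly * (X - C 1) = (F + J).charpoly * (X - C 0) := by
    apply mul_left_cancel₀ (pow_ne_zero (v - 1) (X_ne_zero (R := ℝ)))
    obtain ⟨w, rfl⟩ : ∃ w, v = w + 1 := ⟨v - 1, by omega⟩
    simp only [Nat.add_sub_cancel, map_zero, sub_zero] at hdet ⊢
    linear_combination hdet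
  have h := congrArg Polynomial.roots hfin
  rw [Polynomial.roots_mul (mul_ne_zero (Matrix.charpoly_monic _).ne_zero (X_sub_C_ne_zero _)),
    Polynomial.roots_mul (mul_ne_zero (Matrix.charpoly_monic _).ne_zero (X_sub_C_ne_zero _)),
    roots_X_sub_C, roots_X_sub_C] at h
  exact h

theorem aux_count {v : ℕ} (A : Matrix (Fin v) (Fin v) ℝ) (hA : A.IsHermitian) :
    (1 - A).charpoly.roots.countP (fun x => x ≠ 1) = A.rank := by
  have hA' : (-A).IsHermitian := hA.neg
  have h1 : 1 - A = -A - Matrix.scalar (Fin v) (-1) := by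
    have : Matrix.scalar (Fin v) (-1 : ℝ) = -1 := by rw [map_neg, map_one]
    rw [this]; abel
  have h2 : (1 - A).charpoly = ∏ i, (X - C (hA'.eigenvalues i + 1)) := by
    rw [h1, Matrix.charpoly_sub_scalar, hA'.charpoly_eq, Polynomial.prod_comp]
    refine Finset.prod_congr rfl fun i _ => ?_
    simp
    ring
  have h3 : (1 - A).charpoly.roots = Multiset.map (fun i => hA'.eigenvalues i + 1) Finset.univ.val := by
    rw [h2, Polynomial.roots_prod _ _ (Finset.prod_ne_zero_iff.2 fun i _ => X_sub_C_ne_zero _)]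
    simp only [roots_X_sub_C, Multiset.bind_singleton]
  have h4 : (-A).rank = A.rank := by
    have h5 : -A = Matrix.scalar (Fin v) (-1 : ℝ) * A := by rw [map_neg, map_one, neg_one_mul]
    rw [h5]
    refine Matrix.rank_mul_eq_right_of_isUnit_det _ _ ?_
    simp
  rw [← h4, hA'.rank_eq_card_non_zero_eigs, h3, Multiset.countP_map, Fintype.card_subtype]
  simp
  rfl

theorem aux_eig {v : ℕ} (A : Matrix (Fin v) (Fin v) ℝ) (t : ℝ) (ht : t ∈ A.charpoly.roots) :
    ∃ w : Fin v → ℝ, w ≠ 0 ∧ A *ᵥ w = t • w := by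
  have h := (Polynomial.mem_roots'.1 ht).2
  rw [Polynomial.IsRoot, Matrix.eval_charpoly] at h
  obtain ⟨w, hw, h⟩ := Matrix.exists_mulVec_eq_zero_iff.2 h
  refine ⟨w, hw, ?_⟩
  rw [Matrix.sub_mulVec] at h
  have : Matrix.scalar (Fin v) t *ᵥ w = t • w := by
    ext i; simp [Matrix.mulVec_diagonal]
  rw [this] at h
  exact (sub_eq_zero.1 h).symm

/-- quadratic form bound -/
theorem aux_quad {v : ℕ} (H : Matrix (Fin v) (Fin v) ℝ) (hH : H.IsHermitian) (c : ℝ)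
    (h : ∀ t ∈ H.charpoly.roots, c ≤ t) (w : Fin v → ℝ) :
    c * (w ⬝ᵥ w) ≤ w ⬝ᵥ (H *ᵥ w) := by
  have hK : (H - Matrix.scalar (Fin v) c).IsHermitian := by
    refine hH.sub ?_
    simp [Matrix.IsHermitian]
  have hps : (H - Matrix.scalar (Fin v) c).PosSemidef := by
    rw [hK.posSemidef_iff_eigenvalues_nonneg]
    intro i
    have hr : hK.eigenvalues i ∈ (H - Matrix.scalar (Fin v) c).charpoly.roots := by
      rw [hK.roots_charpoly_eq_eigenvalues]
      simp
    have h0 := (Polynomial.mem_roots'.1 hr).2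
    rw [Matrix.charpoly_sub_scalar, Polynomial.IsRoot, Polynomial.eval_comp] at h0
    have := h (hK.eigenvalues i + c)
      (Polynomial.mem_roots'.2 ⟨(Matrix.charpoly_monic _).ne_zero, by simpa using h0⟩)
    change 0 ≤ hK.eigenvalues i
    linarith
  have := hps.re_dotProduct_nonneg w
  rw [Matrix.sub_mulVec, dotProduct_sub] at this
  have e : Matrix.scalar (Fin v) c *ᵥ w = c • w := by
    ext i; simp [Matrix.mulVec_diagonal]
  rw [e] at this
  simpa using this

namespace BlockDesign

variable {v b r k : ℕ}

/-- incidence matrix -/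
noncomputable def inc (D : BlockDesign v b r k) : Matrix (Fin v) (Fin b) ℝ :=
  Matrix.of fun α j => if α ∈ D.blocks j then 1 else 0

theorem inc_apply (D : BlockDesign v b r k) (α : Fin v) (j : Fin b) :
    D.inc α j = if α ∈ D.blocks j then 1 else 0 := rfl

theorem inc_col (D : BlockDesign v b r k) (j : Fin b) : ∑ α, D.inc α j = k := by
  simp [inc_apply, D.blockSize]

theorem inc_row (D : BlockDesign v b r k) (α : Fin v) : ∑ j, D.inc α j = r := by
  simp [inc_apply, D.replication]

theorem inc_class (D : BlockDesign v b r k) {π : Fin b → Fin r} (hπ : D.IsResolution π)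
    (c : Fin r) (α : Fin v) : ∑ j with π j = c, D.inc α j = 1 := by
  obtain ⟨j, ⟨h1, h2⟩, h3⟩ := hπ c α
  rw [Finset.sum_eq_single j]
  · simp [inc_apply, h2]
  · intro i hi hne
    rw [inc_apply, if_neg]
    intro h
    exact hne (h3 i ⟨by simpa using hi, h⟩)
  · intro h; simp [h1] at h

theorem class_card (D : BlockDesign v b r k) {π : Fin b → Fin r} (hπ : D.IsResolution π)
    (hk : 0 < k) {s : ℕ} (hvs : v = k * s) (c : Fin r) :
    (Finset.univ.filter fun j => π j = c).card = s := by
  have h : ∑ j with π j = c, ∑ α, D.inc α j = v := by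
    rw [Finset.sum_comm]
    simp [D.inc_class hπ c]
  simp only [inc_col, Finset.sum_const, nsmul_eq_mul] at h
  have h2 : (Finset.univ.filter fun j => π j = c).card * k = v := by exact_mod_cast h
  rw [hvs, mul_comm] at h2
  exact Nat.eq_of_mul_eq_mul_left hk h2

theorem b_eq (D : BlockDesign v b r k) {π : Fin b → Fin r} (hπ : D.IsResolution π)
    (hk : 0 < k) {s : ℕ} (hvs : v = k * s) : b = r * s := by
  have := Finset.card_eq_sum_card_fiberwise (f := π) (s := Finset.univ) (t := Finset.univ)
    (fun _ _ => by simp)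
  simpa [D.class_card hπ hk hvs] using this

theorem infoMatrix_eq (D : BlockDesign v b r k) :
    D.infoMatrix = 1 - ((r : ℝ) * (k : ℝ))⁻¹ • (D.inc * D.incᵀ) := by
  rw [infoMatrix]
  congr 2
  ext α β
  simp only [Matrix.of_apply, concurrence, Matrix.mul_apply, Matrix.transpose_apply, inc_apply]
  rw [Finset.card_filter]
  push_cast
  refine Finset.sum_congr rfl fun j _ => ?_
  by_cases h1 : α ∈ D.blocks j <;> by_cases h2 : β ∈ D.blocks j <;> simp [h1, h2]

theorem incT_one (D : BlockDesign v b r k) : D.incᵀ *ᵥ (fun _ => (1 : ℝ)) = fun _ => (k : ℝ) := by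
  ext j; simp [Matrix.mulVec, dotProduct, inc_col]

theorem info_one (D : BlockDesign v b r k) (hr : 0 < r) (hk : 0 < k) :
    D.infoMatrix *ᵥ (fun _ => (1 : ℝ)) = 0 := by
  rw [infoMatrix_eq, Matrix.sub_mulVec, Matrix.smul_mulVec, ← Matrix.mulVec_mulVec, incT_one]
  ext α
  have : ∑ j, D.inc α j * (k : ℝ) = r * k := by rw [← Finset.sum_mul, inc_row]
  have hrR : (r : ℝ) ≠ 0 := by exact_mod_cast hr.ne'
  have hkR : (k : ℝ) ≠ 0 := by exact_mod_cast hk.ne'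
  simp only [Matrix.one_mulVec, Pi.sub_apply, Pi.smul_apply, Matrix.mulVec, dotProduct, this,
    smul_eq_mul, Pi.zero_apply]
  field_simp
  simp

theorem gram_herm (D : BlockDesign v b r k) :
    (((r : ℝ) * (k : ℝ))⁻¹ • (D.inc * D.incᵀ)).IsHermitian := by
  rw [Matrix.IsHermitian, Matrix.conjTranspose_eq_transpose_of_trivial, Matrix.transpose_smul,
    Matrix.transpose_mul, Matrix.transpose_transpose]

theorem info_herm (D : BlockDesign v b r k) : D.infoMatrix.IsHermitian := by
  rw [infoMatrix_eq]
  exact Matrix.isHermitian_one.sub D.gram_herm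

/-- information matrix plus `J/v` -/
noncomputable def hmat (D : BlockDesign v b r k) : Matrix (Fin v) (Fin v) ℝ :=
  D.infoMatrix + Matrix.vecMulVec (fun _ => (1 : ℝ)) (fun _ => (v : ℝ)⁻¹)

theorem hmat_herm (D : BlockDesign v b r k) : D.hmat.IsHermitian := by
  refine D.info_herm.add ?_
  ext i j
  simp [Matrix.vecMulVec]

theorem hmat_mulVec (D : BlockDesign v b r k) (w : Fin v → ℝ) :
    D.hmat *ᵥ w = w - ((r : ℝ) * (k : ℝ))⁻¹ • (D.inc *ᵥ (D.incᵀ *ᵥ w)) +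
      fun _ => (v : ℝ)⁻¹ * ∑ α, w α := by
  rw [hmat, Matrix.add_mulVec, infoMatrix_eq, Matrix.sub_mulVec, Matrix.smul_mulVec,
    ← Matrix.mulVec_mulVec, Matrix.one_mulVec]
  congr 1
  ext i
  simp [Matrix.mulVec, dotProduct, Matrix.vecMulVec, Finset.mul_sum]

theorem zero_mem_roots (D : BlockDesign v b r k) (hv : 0 < v) (hr : 0 < r) (hk : 0 < k) :
    (0 : ℝ) ∈ D.infoMatrix.charpoly.roots := by
  have h := aux_roots hv D.infoMatrix (D.info_one hr hk)
  have : (0 : ℝ) ∈ D.infoMatrix.charpoly.roots + {1} := by rw [h]; simp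
  simpa using this

theorem eff_add_one (D : BlockDesign v b r k) (hv : 0 < v) (hr : 0 < r) (hk : 0 < k) :
    D.effFactors + {1} = D.hmat.charpoly.roots := by
  have h := aux_roots hv D.infoMatrix (D.info_one hr hk)
  have h0 := D.zero_mem_roots hv hr hk
  rw [← Multiset.cons_erase h0] at h
  rw [effFactors]
  have h2 : (0 : ℝ) ::ₘ (D.infoMatrix.charpoly.roots.erase 0 + {1}) =
      0 ::ₘ D.hmat.charpoly.roots := by
    rw [← Multiset.cons_add, h, hmat, Multiset.add_comm]; rfl
  exact (Multiset.cons_inj_right 0).1 h2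

theorem mem_root_of_eff (D : BlockDesign v b r k) {t : ℝ} (ht : t ∈ D.effFactors) :
    t ∈ D.infoMatrix.charpoly.roots := Multiset.mem_of_mem_erase ht

theorem eff_card (D : BlockDesign v b r k) (hv : 0 < v) (hr : 0 < r) (hk : 0 < k) :
    D.effFactors.card = v - 1 := by
  rw [effFactors, Multiset.card_erase_of_mem (D.zero_mem_roots hv hr hk),
    D.info_herm.roots_charpoly_eq_eigenvalues]
  simp

theorem eff_sum (D : BlockDesign v b r k) (hv : 0 < v) (hr : 0 < r) (hk : 0 < k)
    {s : ℕ} (hvs : v = k * s) :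
    D.effFactors.sum = v - s := by
  have h : D.effFactors.sum = D.infoMatrix.charpoly.roots.sum := by
    rw [← Multiset.cons_erase (D.zero_mem_roots hv hr hk), Multiset.sum_cons, zero_add, effFactors]
  rw [h, ← Matrix.trace_eq_sum_roots_charpoly_of_splits D.info_herm.splits_charpoly,
    infoMatrix_eq, Matrix.trace_sub, Matrix.trace_one, Matrix.trace_smul, Fintype.card_fin]
  have h2 : (D.inc * D.incᵀ).trace = v * r := by
    simp only [Matrix.trace, Matrix.diag, Matrix.mul_apply, Matrix.transpose_apply]
    have : ∀ α, ∑ j, D.inc α j * D.inc α j = r := by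
      intro α
      rw [← D.inc_row α]
      refine Finset.sum_congr rfl fun j _ => ?_
      rw [inc_apply]; split_ifs <;> simp
    simp [this]
  have hrR : (r : ℝ) ≠ 0 := by exact_mod_cast hr.ne'
  have hkR : (k : ℝ) ≠ 0 := by exact_mod_cast hk.ne'
  rw [h2, hvs]
  push_cast
  simp only [smul_eq_mul]
  field_simp

theorem eff_le_one (D : BlockDesign v b r k) (hr : 0 < r) (hk : 0 < k)
    {t : ℝ} (ht : t ∈ D.effFactors) : t ≤ 1 := by
  obtain ⟨w, hw, h⟩ := aux_eig _ _ (D.mem_root_of_eff ht)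
  rw [infoMatrix_eq, Matrix.sub_mulVec, Matrix.smul_mulVec, ← Matrix.mulVec_mulVec,
    Matrix.one_mulVec] at h
  have h2 := congrArg (fun x => w ⬝ᵥ x) h
  simp only [dotProduct_sub, dotProduct_smul, smul_eq_mul] at h2
  rw [Matrix.dotProduct_mulVec, ← Matrix.mulVec_transpose] at h2
  have hpos : 0 < w ⬝ᵥ w := by
    have := Matrix.dotProduct_star_self_pos_iff.2 hw
    simpa using this
  have hn : 0 ≤ (D.incᵀ *ᵥ w) ⬝ᵥ (D.incᵀ *ᵥ w) := Finset.sum_nonneg fun i _ => mul_self_nonneg _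
  have hc : (0 : ℝ) ≤ ((r : ℝ) * k)⁻¹ := by positivity
  have := mul_nonneg hc hn
  have : t * (w ⬝ᵥ w) ≤ 1 * (w ⬝ᵥ w) := by linarith
  exact le_of_mul_le_mul_right this hpos

theorem inc_rank (D : BlockDesign v b r k) {π : Fin b → Fin r} (hπ : D.IsResolution π)
    (hv : 0 < v) : D.inc.rank + r ≤ b + 1 := by
  have hsurj : Function.Surjective π := by
    intro c
    obtain ⟨j, ⟨h1, _⟩, _⟩ := hπ c ⟨0, hv⟩
    exact ⟨j, h1⟩
  let φ : (Fin r → ℝ) →ₗ[ℝ] (Fin b → ℝ) := LinearMap.funLeft ℝ ℝ π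
  have hφ : Function.Injective φ := LinearMap.funLeft_injective_of_surjective ℝ ℝ π hsurj
  let σ : (Fin r → ℝ) →ₗ[ℝ] ℝ := Fintype.linearCombination ℝ (fun _ : Fin r => (1 : ℝ))
  have hσ := LinearMap.finrank_range_add_finrank_ker σ
  have hσ1 : Module.finrank ℝ (LinearMap.range σ) ≤ 1 := by
    simpa using Submodule.finrank_le (LinearMap.range σ)
  have hmap : Submodule.map φ (LinearMap.ker σ) ≤ LinearMap.ker D.inc.mulVecLin := by
    rintro _ ⟨a, ha, rfl⟩
    have ha : ∑ c, a c = 0 := by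
      have : σ a = 0 := ha
      simpa [σ, Fintype.linearCombination_apply] using this
    rw [LinearMap.mem_ker, Matrix.mulVecLin_apply]
    ext α
    simp only [Matrix.mulVec, dotProduct, Pi.zero_apply, φ, LinearMap.funLeft_apply]
    rw [← Finset.sum_fiberwise Finset.univ π, ← ha]
    refine Finset.sum_congr rfl fun c _ => ?_
    have : ∀ j ∈ Finset.univ.filter (fun j => π j = c), D.inc α j * a (π j) = D.inc α j * a c := by
      intro j hj
      rw [(Finset.mem_filter.1 hj).2]
    rw [Finset.sum_congr rfl this, ← Finset.sum_mul, D.inc_class hπ, one_mul]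
  have h1 := Submodule.finrank_mono hmap
  rw [← LinearEquiv.finrank_eq (Submodule.equivMapOfInjective φ hφ (LinearMap.ker σ))] at h1
  have h2 := LinearMap.finrank_range_add_finrank_ker D.inc.mulVecLin
  simp only [Module.finrank_fintype_fun_eq_card, Fintype.card_fin] at h2 hσ
  have h3 : D.inc.rank = Module.finrank ℝ (LinearMap.range D.inc.mulVecLin) := rfl
  omega

theorem eff_count (D : BlockDesign v b r k) {π : Fin b → Fin r} (hπ : D.IsResolution π)
    (hv : 0 < v) (hr : 0 < r) (hk : 0 < k) {s : ℕ} (hs : 1 < s) (hvs : v = k * s) :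
    D.effFactors.countP (fun x => x ≠ 1) ≤ r * (s - 1) := by
  have h := aux_count _ D.gram_herm
  rw [← infoMatrix_eq, ← Multiset.cons_erase (D.zero_mem_roots hv hr hk),
    Multiset.countP_cons_of_pos _ (by norm_num)] at h
  change D.effFactors.countP _ + 1 = _ at h
  have h1 : (((r : ℝ) * (k : ℝ))⁻¹ • (D.inc * D.incᵀ)).rank ≤ D.inc.rank := by
    rw [← Matrix.mul_smul]
    exact Matrix.rank_mul_le_left _ _
  have h2 := D.inc_rank hπ hv
  have h3 := D.b_eq hπ hk hvs
  obtain ⟨q, rfl⟩ : ∃ q, s = q + 1 := ⟨s - 1, by omega⟩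
  rw [Nat.mul_succ] at h3
  rw [Nat.add_sub_cancel]
  omega

theorem sorted_sum (D : BlockDesign v b r k) : D.sortedEff.sum = D.effFactors.sum := by
  rw [← Multiset.sum_coe, sortedEff, Multiset.sort_eq]

theorem sorted_length (D : BlockDesign v b r k) : D.sortedEff.length = D.effFactors.card :=
  Multiset.length_sort _

theorem sorted_mem (D : BlockDesign v b r k) {t : ℝ} : t ∈ D.sortedEff ↔ t ∈ D.effFactors :=
  Multiset.mem_sort _

theorem sorted_pairwise (D : BlockDesign v b r k) : D.sortedEff.Pairwise (· ≤ ·) :=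
  Multiset.pairwise_sort _ _

theorem sorted_count (D : BlockDesign v b r k) :
    D.sortedEff.countP (fun x => decide (x ≠ 1)) = D.effFactors.countP (fun x => x ≠ 1) := by
  rw [← Multiset.coe_countP, sortedEff, Multiset.sort_eq]

theorem inter_sum (D : BlockDesign v b r k) (j i : Fin b) :
    ∑ α, D.inc α j * D.inc α i = ((D.blocks j ∩ D.blocks i).card : ℝ) := by
  have : ∀ α, D.inc α j * D.inc α i = if α ∈ D.blocks j ∩ D.blocks i then 1 else 0 := by
    intro α
    simp only [inc_apply, Finset.mem_inter]
    by_cases h1 : α ∈ D.blocks j <;> by_cases h2 : α ∈ D.blocks i <;> simp [h1, h2]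
  rw [Finset.sum_congr rfl fun α _ => this α, Finset.sum_ite_mem]
  simp

theorem inter_same (D : BlockDesign v b r k) {π : Fin b → Fin r} (hπ : D.IsResolution π)
    {j i : Fin b} (h : π i = π j) (hne : i ≠ j) : D.blocks j ∩ D.blocks i = ∅ := by
  rw [Finset.eq_empty_iff_forall_notMem]
  intro α hα
  rw [Finset.mem_inter] at hα
  exact hne ((hπ (π j) α).unique ⟨h, hα.2⟩ ⟨rfl, hα.1⟩)

theorem sum_gram (D : BlockDesign v b r k) (w : Fin v → ℝ) :
    ∑ α, (D.inc *ᵥ (D.incᵀ *ᵥ w)) α = r * k * ∑ α, w α := by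
  simp only [Matrix.mulVec, dotProduct, Matrix.transpose_apply]
  rw [Finset.sum_comm]
  simp only [← Finset.sum_mul, inc_col]
  rw [← Finset.mul_sum, Finset.sum_comm]
  simp only [← Finset.sum_mul, inc_row]
  rw [← Finset.mul_sum]
  ring

theorem affine_bound (D : BlockDesign v b r k) (hD : D.IsAffineResolvable)
    (hv : 0 < v) (hr : 0 < r) (hk : 0 < k) {t : ℝ} (ht : t ∈ D.effFactors) :
    1 - 1 / (r : ℝ) ≤ t := by
  obtain ⟨-, -, π, hπ, μ, -, hμ⟩ := hD
  have hrR : (0 : ℝ) < r := by exact_mod_cast hr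
  have hkR : (0 : ℝ) < k := by exact_mod_cast hk
  have hvR : (v : ℝ) ≠ 0 := by exact_mod_cast hv.ne'
  by_cases ht1 : t = 1
  · rw [ht1]
    have : 0 < 1 / (r : ℝ) := by positivity
    linarith
  have ht' : t ∈ D.hmat.charpoly.roots := by
    rw [← D.eff_add_one hv hr hk]
    exact Multiset.mem_add.2 (Or.inl ht)
  obtain ⟨w, hw, h⟩ := aux_eig _ _ ht'
  rw [hmat_mulVec] at h
  have hsum : ∑ α, w α = 0 := by
    have h2 := congrArg (fun x : Fin v → ℝ => ∑ α, x α) h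
    simp only [Pi.add_apply, Pi.sub_apply, Pi.smul_apply, Finset.sum_add_distrib,
      Finset.sum_sub_distrib, smul_eq_mul, ← Finset.mul_sum, sum_gram, Finset.sum_const,
      Finset.card_univ, Fintype.card_fin, nsmul_eq_mul] at h2
    rw [← mul_assoc, inv_mul_cancel₀ (by positivity), inv_mul_cancel_left₀ hvR] at h2
    have h3 : (1 - t) * ∑ α, w α = 0 := by linarith
    exact (mul_eq_zero.1 h3).resolve_left (sub_ne_zero.2 (Ne.symm ht1))
  set u := D.incᵀ *ᵥ w with hu
  have hNu : ∀ α, (D.inc *ᵥ u) α = r * k * (1 - t) * w α := by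
    intro α
    have h2 := congrFun h α
    simp only [Pi.add_apply, Pi.sub_apply, Pi.smul_apply, smul_eq_mul, hsum, mul_zero,
      add_zero] at h2
    have h3 : ((r : ℝ) * k)⁻¹ * (D.inc *ᵥ u) α = (1 - t) * w α := by linarith
    rw [inv_mul_eq_iff_eq_mul₀ (by positivity)] at h3
    rw [h3]; ring
  have hclass : ∀ c, ∑ i with π i = c, u i = 0 := by
    intro c
    simp only [hu, Matrix.mulVec, dotProduct, Matrix.transpose_apply]
    rw [Finset.sum_comm]
    simp only [← Finset.sum_mul, D.inc_class hπ, one_mul, hsum]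
  have hku : ∀ j, r * k * (1 - t) * u j = k * u j := by
    intro j
    have e1 : ∑ α, D.inc α j * (D.inc *ᵥ u) α = r * k * (1 - t) * u j := by
      simp only [hNu]
      simp only [hu, Matrix.mulVec, dotProduct, Matrix.transpose_apply, Finset.mul_sum]
      refine Finset.sum_congr rfl fun α _ => by ring
    have e2 : ∑ α, D.inc α j * (D.inc *ᵥ u) α =
        ∑ i, ((D.blocks j ∩ D.blocks i).card : ℝ) * u i := by
      simp only [Matrix.mulVec, dotProduct, Finset.mul_sum, ← inter_sum, Finset.sum_mul]
      rw [Finset.sum_comm]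
      refine Finset.sum_congr rfl fun i _ => Finset.sum_congr rfl fun α _ => by ring
    rw [← e1, e2, ← Finset.sum_fiberwise Finset.univ π, Finset.sum_eq_single (π j)]
    · rw [Finset.sum_eq_single j]
      · rw [Finset.inter_self, D.blockSize]
      · intro i hi hne
        rw [D.inter_same hπ (by simpa using hi) hne]
        simp
      · simp
    · intro c _ hc
      have : ∀ i ∈ Finset.univ.filter (fun i => π i = c),
          ((D.blocks j ∩ D.blocks i).card : ℝ) * u i = μ * u i := by
        intro i hi
        rw [hμ j i (by rw [(Finset.mem_filter.1 hi).2]; exact hc.symm)]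
      rw [Finset.sum_congr rfl this, ← Finset.mul_sum, hclass, mul_zero]
    · simp
  have hune : ∃ j, u j ≠ 0 := by
    by_contra hcon
    push Not at hcon
    apply hw
    ext α
    have h2 := hNu α
    have : (D.inc *ᵥ u) α = 0 := by simp [Matrix.mulVec, dotProduct, hcon]
    rw [this] at h2
    have h3 : (r : ℝ) * k * (1 - t) ≠ 0 :=
      mul_ne_zero (by positivity) (sub_ne_zero.2 (Ne.symm ht1))
    exact (mul_eq_zero.1 h2.symm).resolve_left h3
  obtain ⟨j, hj⟩ := hune
  have h4 := mul_right_cancel₀ hj (hku j)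
  have h5 : (k : ℝ) * (r * (1 - t)) = k * 1 := by linarith
  have h6 := mul_left_cancel₀ hkR.ne' h5
  have h7 : 1 / (r : ℝ) = 1 - t := by rw [div_eq_iff hrR.ne']; linarith
  linarith

theorem affine_of_bound (D : BlockDesign v b r k) (hD : D.IsResolvable)
    (hv : 0 < v) (hr : 0 < r) (hk : 0 < k) {s : ℕ} (hs : 1 < s) (hvs : v = k * s)
    (hb : ∀ t ∈ D.effFactors, 1 - 1 / (r : ℝ) ≤ t) : D.IsAffineResolvable := by
  obtain ⟨hkv, hr1, π, hπ⟩ := hD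
  have hrR : (0 : ℝ) < r := by exact_mod_cast hr
  have hkR : (0 : ℝ) < k := by exact_mod_cast hk
  have hsR : (0 : ℝ) < s := by exact_mod_cast (by omega : 0 < s)
  have hvR : (v : ℝ) = k * s := by exact_mod_cast hvs
  have hH : ∀ t ∈ D.hmat.charpoly.roots, 1 - 1 / (r : ℝ) ≤ t := by
    intro t ht
    rw [← D.eff_add_one hv hr hk, Multiset.mem_add] at ht
    rcases ht with ht | ht
    · exact hb t ht
    · rw [Multiset.mem_singleton.1 ht]
      have : 0 < 1 / (r : ℝ) := by positivity
      linarith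
  have key : ∀ j i, π j ≠ π i → ((D.blocks j ∩ D.blocks i).card : ℝ) = k / s := by
    intro j i hji
    have hq := aux_quad D.hmat D.hmat_herm _ hH (fun α => D.inc α j - 1 / s)
    set w : Fin v → ℝ := fun α => D.inc α j - 1 / s with hw
    have hsum : ∑ α, w α = 0 := by
      simp only [hw, Finset.sum_sub_distrib, inc_col, Finset.sum_const, Finset.card_univ,
        Fintype.card_fin, nsmul_eq_mul, hvR]
      field_simp
      simp
    have hww : w ⬝ᵥ w = k - k / s := by
      have : w ⬝ᵥ w = ∑ α, D.inc α j * w α := by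
        have e : w ⬝ᵥ w = ∑ α, (D.inc α j * w α - 1 / s * w α) :=
          Finset.sum_congr rfl fun α _ => by simp only [hw]; ring
        rw [e, Finset.sum_sub_distrib, ← Finset.mul_sum, hsum]; simp
      rw [this]
      simp only [hw, mul_sub, Finset.sum_sub_distrib, inter_sum, Finset.inter_self, D.blockSize,
        ← Finset.sum_mul, inc_col]
      ring
    set u := D.incᵀ *ᵥ w with hu
    have hui : ∀ i, u i = ((D.blocks j ∩ D.blocks i).card : ℝ) - k / s := by
      intro i
      simp only [hu, hw, Matrix.mulVec, dotProduct, Matrix.transpose_apply, mul_sub,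
        Finset.sum_sub_distrib, ← Finset.sum_mul, inc_col]
      rw [← inter_sum]
      congr 1
      · exact Finset.sum_congr rfl fun α _ => by ring
      · ring
    rw [hmat_mulVec, hsum, hww, dotProduct_add, dotProduct_sub, dotProduct_smul, hww,
      Matrix.dotProduct_mulVec, ← Matrix.mulVec_transpose, ← hu] at hq
    have hz : w ⬝ᵥ (fun _ => (v : ℝ)⁻¹ * 0) = 0 := by simp [dotProduct]
    rw [hz, smul_eq_mul, add_zero] at hq
    have hq2 : ((r : ℝ) * k)⁻¹ * (u ⬝ᵥ u) ≤ 1 / r * (k - k / s) := by linarith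
    rw [inv_mul_le_iff₀ (by positivity)] at hq2
    have hq3 : u ⬝ᵥ u ≤ k * (k - k / s) := by
      refine hq2.trans (le_of_eq ?_)
      field_simp
    have hcl : ∑ i with π i = π j, u i * u i = k * (k - k / s) := by
      have e1 : ∀ i, u i * u i = ((D.blocks j ∩ D.blocks i).card : ℝ) *
          (((D.blocks j ∩ D.blocks i).card : ℝ) - 2 * (k / s)) + (k / s) * (k / s) := by
        intro i; rw [hui]; ring
      simp only [e1, Finset.sum_add_distrib, Finset.sum_const, D.class_card hπ hk hvs,
        nsmul_eq_mul]
      rw [Finset.sum_eq_single j]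
      · rw [Finset.inter_self, D.blockSize]
        field_simp
        ring
      · intro i hi hne
        rw [D.inter_same hπ (by simpa using hi) hne]
        simp
      · simp
    have hsplit := Finset.sum_filter_add_sum_filter_not Finset.univ (fun i => π i = π j)
      (fun i => u i * u i)
    have hle : u i * u i ≤ ∑ i with ¬ π i = π j, u i * u i :=
      Finset.single_le_sum (f := fun i => u i * u i) (fun i _ => mul_self_nonneg _)
        (by simpa using hji.symm)
    have hdot : u ⬝ᵥ u = ∑ i, u i * u i := rfl
    have h0 : u i * u i ≤ 0 := by linarith
    have h1 : u i = 0 := mul_self_eq_zero.1 (le_antisymm h0 (mul_self_nonneg _))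
    rw [hui] at h1
    linarith
  have keyN : ∀ j i, π j ≠ π i → (D.blocks j ∩ D.blocks i).card * s = k := by
    intro j i hji
    have := key j i hji
    rw [eq_div_iff hsR.ne'] at this
    exact_mod_cast this
  obtain ⟨j0, ⟨hj0, _⟩, _⟩ := hπ ⟨0, by omega⟩ ⟨0, hv⟩
  obtain ⟨j1, ⟨hj1, _⟩, _⟩ := hπ ⟨1, hr1⟩ ⟨0, hv⟩
  have hne : π j0 ≠ π j1 := by rw [hj0, hj1]; simp
  have h01 := keyN j0 j1 hne
  refine ⟨hkv, hr1, π, hπ, (D.blocks j0 ∩ D.blocks j1).card, ?_, ?_⟩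
  · rcases Nat.eq_zero_or_pos (D.blocks j0 ∩ D.blocks j1).card with h | h
    · rw [h] at h01; omega
    · exact h
  · intro j j' h
    have := keyN j j' h
    exact Nat.eq_of_mul_eq_mul_right (by omega : 0 < s) (this.trans h01.symm)

end BlockDesign

end Aux

/-- Theorem 1(2) (Bose–Morgan–Mukhopadhyay): if an affine resolvable `(v,b,r,k)`-design
exists (with `r > 2`, `s = v/k > 1`), then a resolvable `(v,b,r,k)`-design is Schur
optimal in the class of all resolvable `(v,b,r,k)`-designs iff it is affine resolvable. -/
theorem schur_optimal_resolvable_iff_affine (v b r k s : ℕ) (hv : 0 < v) (hb : 0 < b)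
    (hk : 0 < k) (hr : 2 < r) (hs : 1 < s) (hvs : v = k * s)
    (hex : ∃ Δ : BlockDesign v b r k, Δ.IsAffineResolvable)
    (D : BlockDesign v b r k) (hD : D.IsResolvable) :
    D.SchurOptimalIn {Γ : BlockDesign v b r k | Γ.IsResolvable} ↔ D.IsAffineResolvable := by
  have hr0 : 0 < r := by omega
  have hlen : ∀ G : BlockDesign v b r k, G.sortedEff.length = v - 1 := fun G => by
    rw [G.sorted_length, G.eff_card hv hr0 hk]
  have hsum : ∀ G : BlockDesign v b r k,
      G.sortedEff.sum = G.sortedEff.length - ((s : ℝ) - 1) := fun G => by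
    rw [G.sorted_sum, hlen, G.eff_sum hv hr0 hk hvs, Nat.cast_sub hv]
    push_cast; ring
  have hle1 : ∀ G : BlockDesign v b r k, ∀ x ∈ G.sortedEff, x ≤ 1 := fun G x hx =>
    G.eff_le_one hr0 hk (G.sorted_mem.1 hx)
  have hlow : ∀ G : BlockDesign v b r k, G.IsAffineResolvable → ∀ l, l ≤ v - 1 →
      l - ((s : ℝ) - 1) ≤ (G.sortedEff.take l).sum ∧
      l - (l : ℝ) / r ≤ (G.sortedEff.take l).sum := fun G hG l hl =>
    aux_lower _ (hle1 G) r s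
      (fun x hx => G.affine_bound hG hv hr0 hk (G.sorted_mem.1 hx)) (hsum G) l (by rw [hlen]; exact hl)
  constructor
  · rintro ⟨-, hopt⟩
    obtain ⟨E, hE⟩ := hex
    have hEr : E.IsResolvable := by
      obtain ⟨h1, h2, π, hπ, -⟩ := hE
      exact ⟨h1, h2, π, hπ⟩
    have hv1 : 1 ≤ v - 1 := by
      have := hD.1
      omega
    have h1 := hopt E hEr 1 le_rfl hv1
    have h2 := (hlow E hE 1 hv1).2
    refine D.affine_of_bound hD hv hr0 hk hs hvs ?_
    intro t ht
    have ht' := D.sorted_mem.2 ht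
    have hp := D.sorted_pairwise
    cases hL : D.sortedEff with
    | nil => rw [hL] at ht'; simp at ht'
    | cons a L =>
      rw [hL] at ht' hp h1
      simp only [List.take_succ_cons, List.take_zero, List.sum_cons, List.sum_nil, add_zero] at h1
      have ha : 1 - 1 / (r : ℝ) ≤ a := by
        rw [Nat.cast_one] at h2
        linarith
      rcases List.mem_cons.1 ht' with h | h
      · rw [h]; exact ha
      · exact ha.trans ((List.pairwise_cons.1 hp).1 t h)
  · intro hA
    refine ⟨hD, ?_⟩
    intro G hG l _ hl
    obtain ⟨-, -, π, hπ⟩ := hG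
    have hl' := hlow D hA l hl
    rcases aux_upper G.sortedEff G.sorted_pairwise (hle1 G) r s hr0 hs (hsum G)
      (by rw [G.sorted_count]; exact G.eff_count hπ hv hr0 hk hs hvs) l
      (by rw [hlen]; exact hl) with h | h
    · exact h.trans hl'.1
    · exact h.trans hl'.2
end

section
/- Let n > 2 and let S be a uniform (n×n)/k semi-Latin square. Then the eigenvalues of the scaled information matrix of the underlying block design of S, counted with multiplicity, are: 0 with multiplicity 1, 1 − 1/(n−1) with multiplicity (n−1)², and 1 with multiplicity nk − 1 − (n−1)²; equivalently, the canonical efficiency factors of S are 1 − 1/(n−1) with multiplicity (n−1)² and 1 with multiplicity nk − 1 − (n−1)². -/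
open Polynomial

theorem aux_three (s : Multiset ℝ) (θ : ℝ) (h : ∀ x ∈ s, x = 0 ∨ x = θ ∨ x = 1) :
    ∃ a b c : ℕ, s = Multiset.replicate a 0 + Multiset.replicate b θ + Multiset.replicate c 1 := by
  induction s using Multiset.induction with
  | empty => exact ⟨0, 0, 0, by simp⟩
  | cons x s ih =>
    obtain ⟨a, b, c, rfl⟩ := ih (fun y hy => h y (Multiset.mem_cons_of_mem hy))
    rcases h x (Multiset.mem_cons_self _ _) with rfl | rfl | rfl
    · exact ⟨a + 1, b, c, by simp [Multiset.replicate_succ]⟩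
    · exact ⟨a, b + 1, c, by simp [Multiset.replicate_succ]⟩
    · exact ⟨a, b, c + 1, by simp [Multiset.replicate_succ]⟩

theorem aux_spec_s2 {ι : Type*} [Fintype ι] [DecidableEq ι] (A : Matrix ι ι ℝ) (hA : A.IsHermitian)
    (θ : ℝ) (a b c : ℕ) (h0 : θ ≠ 0) (h1 : θ ≠ 1)
    (hcard : Fintype.card ι = a + b + c)
    (ht : A.trace = θ * b + c) (ht2 : (A * A).trace = θ ^ 2 * b + c)
    (hp : A * ((A - θ • 1) * (A - 1)) = 0) :
    A.charpoly.roots =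
      Multiset.replicate a 0 + Multiset.replicate b θ + Multiset.replicate c 1 := by
  have hr := hA.roots_charpoly_eq_eigenvalues
  have hev : ∀ x ∈ A.charpoly.roots, x = 0 ∨ x = θ ∨ x = 1 := by
    intro x hx
    rw [hr] at hx
    obtain ⟨i, -, rfl⟩ := Multiset.mem_map.1 hx
    have hv := hA.mulVec_eigenvectorBasis i
    have hne : (⇑(hA.eigenvectorBasis i) : ι → ℝ) ≠ 0 := by
      intro h
      have h2 := hA.eigenvectorBasis.orthonormal.ne_zero i
      apply h2
      ext j
      exact congrFun h j
    set v : ι → ℝ := ⇑(hA.eigenvectorBasis i) with hvdef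
    set l := hA.eigenvalues i
    have e := congrArg (fun M => M.mulVec v) hp
    simp only [← Matrix.mulVec_mulVec, Matrix.sub_mulVec, Matrix.smul_mulVec, Matrix.one_mulVec,
      hv, Matrix.zero_mulVec, Matrix.mulVec_sub, Matrix.mulVec_smul, smul_smul] at e
    have e2 : (l * (l - θ) * (l - 1)) • v = 0 := by
      rw [← e]; module
    rcases smul_eq_zero.1 e2 with h | h
    · rcases mul_eq_zero.1 h with h | h
      · rcases mul_eq_zero.1 h with h | h
        · left; simpa using h
        · right; left; simp; linarith
      · right; right; simp; linarith
    · exact absurd h hne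
  have htr : A.trace = A.charpoly.roots.sum :=
    Matrix.trace_eq_sum_roots_charpoly_of_splits hA.splits_charpoly
  have htr2 : (A * A).trace = (A.charpoly.roots.map (fun x => x ^ 2)).sum := by
    rw [hr]
    conv_lhs => rw [hA.spectral_theorem, ← map_mul, Unitary.conjStarAlgAut_apply,
      Matrix.trace_mul_comm, ← mul_assoc]
    simp [Matrix.trace, pow_two]
  have hc : Multiset.card A.charpoly.roots = Fintype.card ι := by
    rw [hr]; simp
  obtain ⟨a', b', c', hs⟩ := aux_three _ θ hev
  rw [hs] at htr htr2 hc ⊢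
  simp only [Multiset.sum_add, Multiset.sum_replicate, Multiset.map_add, Multiset.map_replicate,
    Multiset.card_add, Multiset.card_replicate, nsmul_eq_mul] at htr htr2 hc
  have q1 : θ * ((b' : ℝ) - b) + (c' - c) = 0 := by linarith
  have q2 : θ ^ 2 * ((b' : ℝ) - b) + (c' - c) = 0 := by linarith
  have q3 : (θ * (θ - 1)) * ((b' : ℝ) - b) = 0 := by linarith
  have q4 : (b' : ℝ) - b = 0 := by
    rcases mul_eq_zero.1 q3 with h | h
    · exact absurd h (mul_ne_zero h0 (sub_ne_zero.2 h1))
    · exact h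
  have q5 : (c' : ℝ) - c = 0 := by rw [q4] at q1; linarith
  have r1 : b' = b := by exact_mod_cast sub_eq_zero.1 q4
  have r2 : c' = c := by exact_mod_cast sub_eq_zero.1 q5
  have r3 : a' = a := by omega
  rw [r1, r2, r3]

namespace SemiLatinSquare

variable {n k : ℕ}

/-- incidence indicator -/
def ind (S : SemiLatinSquare n k) (α : Fin (n * k)) (i j : Fin n) : ℝ :=
  if α ∈ S.block i j then 1 else 0

theorem ind_row (S : SemiLatinSquare n k) (α : Fin (n * k)) (i : Fin n) :
    ∑ j, S.ind α i j = 1 := by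
  obtain ⟨j, hj, hu⟩ := S.row_once i α
  rw [Finset.sum_eq_single j]
  · simp [ind, hj]
  · intro b _ hb
    have : α ∉ S.block i b := fun h => hb (hu b h)
    simp [ind, this]
  · simp

theorem ind_col (S : SemiLatinSquare n k) (α : Fin (n * k)) (j : Fin n) :
    ∑ i, S.ind α i j = 1 := by
  obtain ⟨i, hi, hu⟩ := S.col_once j α
  rw [Finset.sum_eq_single i]
  · simp [ind, hi]
  · intro b _ hb
    have : α ∉ S.block b j := fun h => hb (hu b h)
    simp [ind, this]
  · simp

theorem ind_inter (S : SemiLatinSquare n k) (i j i' j' : Fin n) :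
    ∑ α, S.ind α i j * S.ind α i' j' = ((S.block i j ∩ S.block i' j').card : ℝ) := by
  simp only [ind, ← ite_and, mul_ite, mul_one, mul_zero]
  rw [Finset.sum_boole]
  congr 2
  ext α; simp [and_comm]

theorem ind_block (S : SemiLatinSquare n k) (i j : Fin n) : ∑ α, S.ind α i j = k := by
  simp only [ind, Finset.sum_boole]
  have h := S.blockSize i j
  have h2 : (Finset.univ.filter fun α => α ∈ S.block i j) = S.block i j := by
    ext α; simp
  rw [h2, h]

theorem conc_eq (S : SemiLatinSquare n k) (α β : Fin (n * k)) :
    (S.concurrence α β : ℝ) = ∑ i, ∑ j, S.ind α i j * S.ind β i j := by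
  rw [← Fintype.sum_prod_type' (fun i j => S.ind α i j * S.ind β i j)]
  simp only [ind, ← ite_and, mul_ite, mul_one, mul_zero]
  rw [Finset.sum_boole, concurrence]
  congr 2
  ext p; simp [and_comm]

theorem conc_self (S : SemiLatinSquare n k) (α : Fin (n * k)) :
    (S.concurrence α α : ℝ) = n := by
  rw [conc_eq]
  have : ∀ i j, S.ind α i j * S.ind α i j = S.ind α i j := by
    intro i j; simp [ind]
  simp [this, ind_row]

theorem conc_symm (S : SemiLatinSquare n k) (α β : Fin (n * k)) :
    S.concurrence α β = S.concurrence β α := by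
  simp [concurrence, and_comm]

theorem conc_sum (S : SemiLatinSquare n k) (α : Fin (n * k)) :
    ∑ β, (S.concurrence α β : ℝ) = n * k := by
  simp only [conc_eq]
  rw [Finset.sum_comm]
  have : ∀ i, ∑ β, ∑ j, S.ind α i j * S.ind β i j = k := by
    intro i
    rw [Finset.sum_comm]
    simp only [← Finset.mul_sum, ind_block, ← Finset.sum_mul, ind_row, one_mul]
  simp [this]

theorem inter_same_row (S : SemiLatinSquare n k) (i j j' : Fin n) (h : j ≠ j') :
    (S.block i j ∩ S.block i j').card = 0 := by
  rw [Finset.card_eq_zero, Finset.eq_empty_iff_forall_notMem]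
  intro α hα
  rw [Finset.mem_inter] at hα
  exact h ((S.row_once i α).unique hα.1 hα.2)

theorem inter_same_col (S : SemiLatinSquare n k) (i i' j : Fin n) (h : i ≠ i') :
    (S.block i j ∩ S.block i' j).card = 0 := by
  rw [Finset.card_eq_zero, Finset.eq_empty_iff_forall_notMem]
  intro α hα
  rw [Finset.mem_inter] at hα
  exact h ((S.col_once j α).unique hα.1 hα.2)

theorem k_eq (S : SemiLatinSquare n k) (μ : ℕ) (hn : 2 < n) (h : S.UniformWith μ) :
    (k : ℝ) = μ * (n - 1) := by
  let i0 : Fin n := ⟨0, by omega⟩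
  let i1 : Fin n := ⟨1, by omega⟩
  have h01 : i0 ≠ i1 := by simp [i0, i1]
  have e : ∑ j, ∑ α, S.ind α i0 i0 * S.ind α i1 j = k := by
    rw [Finset.sum_comm]
    simp only [← Finset.mul_sum, ind_row, mul_one, ind_block]
  rw [← e]
  have : ∀ j, ∑ α, S.ind α i0 i0 * S.ind α i1 j = μ - (if i0 = j then (μ : ℝ) else 0) := by
    intro j
    rw [ind_inter]
    split_ifs with hj
    · subst hj
      rw [S.inter_same_col _ _ _ h01]; simp
    · rw [h.2 _ _ _ _ h01 hj]; simp
  simp only [this, Finset.sum_sub_distrib]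
  simp
  ring

theorem inter_eq (S : SemiLatinSquare n k) (μ : ℕ) (hn : 2 < n) (h : S.UniformWith μ)
    (i j i' j' : Fin n) : ((S.block i j ∩ S.block i' j').card : ℝ) =
      μ * (1 - (if i = i' then 1 else 0) - (if j = j' then 1 else 0)
        + n * ((if i = i' then 1 else 0) * (if j = j' then 1 else 0))) := by
  by_cases hi : i = i'
  · subst hi
    by_cases hj : j = j'
    · subst hj
      rw [Finset.inter_self, S.blockSize, S.k_eq μ hn h, if_pos rfl, if_pos rfl]; ring
    · rw [S.inter_same_row _ _ _ hj]; simp [hj]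
  · by_cases hj : j = j'
    · subst hj
      rw [S.inter_same_col _ _ _ hi]; simp [hi]
    · rw [h.2 _ _ _ _ hi hj]; simp [hi, hj]

theorem conc_sq (S : SemiLatinSquare n k) (μ : ℕ) (hn : 2 < n) (h : S.UniformWith μ)
    (α β : Fin (n * k)) :
    ∑ γ, (S.concurrence α γ : ℝ) * (S.concurrence γ β : ℝ) =
      μ * (n ^ 2 - 2 * n) + μ * n * S.concurrence α β := by
  have e1 : ∑ γ, (S.concurrence α γ : ℝ) * (S.concurrence γ β : ℝ) =
      ∑ i, ∑ j, ∑ i', ∑ j', S.ind α i j * S.ind β i' j' *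
        ((S.block i j ∩ S.block i' j').card : ℝ) := by
    have hc : ∀ γ, (S.concurrence α γ : ℝ) * (S.concurrence γ β : ℝ) =
      (S.concurrence γ β : ℝ) * (S.concurrence α γ : ℝ) := fun γ => mul_comm _ _
    simp only [hc]
    simp only [conc_eq, ← ind_inter, Finset.sum_mul, Finset.mul_sum]
    rw [Finset.sum_comm]
    refine Finset.sum_congr rfl fun i _ => ?_
    rw [Finset.sum_comm]
    refine Finset.sum_congr rfl fun j _ => ?_
    rw [Finset.sum_comm]
    refine Finset.sum_congr rfl fun i' _ => ?_
    rw [Finset.sum_comm]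
    refine Finset.sum_congr rfl fun j' _ => ?_
    refine Finset.sum_congr rfl fun γ _ => ?_
    ring
  have t1 : ∑ i, ∑ j, ∑ i', ∑ j', S.ind α i j * S.ind β i' j' = (n : ℝ) ^ 2 := by
    simp only [← Finset.mul_sum, ind_row, ← Finset.sum_mul]
    simp [pow_two, ← Finset.sum_mul]
  have t2 : ∑ i, ∑ j, ∑ i', ∑ j', S.ind α i j * S.ind β i' j' * (if i = i' then 1 else 0)
      = (n : ℝ) := by
    simp only [← Finset.sum_mul, ← Finset.mul_sum, ind_row]
    simp [ind_row]
  have t3 : ∑ i, ∑ j, ∑ i', ∑ j', S.ind α i j * S.ind β i' j' * (if j = j' then 1 else 0)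
      = (n : ℝ) := by
    simp only [mul_ite, mul_one, mul_zero, Finset.sum_ite_eq, Finset.mem_univ, if_true,
      ← Finset.mul_sum, ind_col, ind_row]
    simp
  have t4 : ∑ i, ∑ j, ∑ i', ∑ j', S.ind α i j * S.ind β i' j' *
      ((if i = i' then 1 else 0) * (if j = j' then 1 else 0)) = (S.concurrence α β : ℝ) := by
    rw [conc_eq]
    simp
  rw [e1]
  have : ∀ i j i' j', S.ind α i j * S.ind β i' j' * ((S.block i j ∩ S.block i' j').card : ℝ) =
      μ * (S.ind α i j * S.ind β i' j') -
      μ * (S.ind α i j * S.ind β i' j' * (if i = i' then 1 else 0)) -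
      μ * (S.ind α i j * S.ind β i' j' * (if j = j' then 1 else 0)) +
      μ * n * (S.ind α i j * S.ind β i' j' *
        ((if i = i' then 1 else 0) * (if j = j' then 1 else 0))) := by
    intro i j i' j'
    rw [S.inter_eq μ hn h]; ring
  have pull : ∀ (c : ℝ) (f : Fin n → Fin n → Fin n → Fin n → ℝ),
      ∑ i, ∑ j, ∑ i', ∑ j', c * f i j i' j' = c * ∑ i, ∑ j, ∑ i', ∑ j', f i j i' j' := by
    intro c f
    simp only [Finset.mul_sum]
  simp only [this, Finset.sum_add_distrib, Finset.sum_sub_distrib]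
  rw [pull, pull, pull, pull, t1, t2, t3, t4]
  ring

end SemiLatinSquare


/-- Theorem 2(1): the eigenvalues, with multiplicity, of the scaled information matrix of
the underlying block design of a uniform `(n×n)/k` semi-Latin square (`n > 2`) are `0`
(once), `1 − 1/(n−1)` (with multiplicity `(n−1)²`) and `1` (with multiplicity
`nk − 1 − (n−1)²`). -/
theorem uniform_sls_eigenvalues (n k : ℕ) (hn : 2 < n) (hk : 0 < k)
    (S : SemiLatinSquare n k) (hS : S.IsUniform) :
    S.infoMatrix.charpoly.roots =
      Multiset.replicate 1 (0 : ℝ) +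
      Multiset.replicate ((n - 1) ^ 2) (1 - 1 / ((n : ℝ) - 1)) +
      Multiset.replicate (n * k - 1 - (n - 1) ^ 2) 1 := by
  obtain ⟨μ, hμ⟩ := hS
  have hkr := S.k_eq μ hn hμ
  have hμ0 := hμ.1
  have hkn : k = μ * (n - 1) := by
    have : (k : ℝ) = ((μ * (n - 1) : ℕ) : ℝ) := by
      rw [hkr]; push_cast [Nat.cast_sub (by omega : 1 ≤ n)]; ring
    exact_mod_cast this
  have hle : 1 + (n - 1) ^ 2 ≤ n * k := by
    obtain ⟨m, rfl⟩ : ∃ m, n = m + 1 := ⟨n - 1, by omega⟩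
    rw [hkn]
    simp only [Nat.add_sub_cancel]
    have : m ≤ μ * m := Nat.le_mul_of_pos_left _ hμ0
    nlinarith
  have hn3 : (2 : ℝ) < n := by exact_mod_cast hn
  have hn1 : (n : ℝ) - 1 ≠ 0 := by linarith
  have hn0 : (n : ℝ) ≠ 0 := by linarith
  have hμr : (μ : ℝ) ≠ 0 := by exact_mod_cast hμ0.ne'
  have hkz : (k : ℝ) ≠ 0 := by exact_mod_cast hk.ne'
  set L : Matrix (Fin (n * k)) (Fin (n * k)) ℝ :=
    Matrix.of (fun α β => (S.concurrence α β : ℝ)) with hL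
  set J : Matrix (Fin (n * k)) (Fin (n * k)) ℝ := Matrix.of (fun _ _ => 1) with hJ
  have hLL : L * L = ((μ : ℝ) * (n ^ 2 - 2 * n)) • J + ((μ : ℝ) * n) • L := by
    ext α β
    simp [Matrix.mul_apply, hL, hJ, S.conc_sq μ hn hμ]
  have hLJ : L * J = ((n : ℝ) * k) • J := by
    ext α β
    simp [Matrix.mul_apply, hL, hJ, S.conc_sum]
  have htL : L.trace = n * k * n := by
    simp [Matrix.trace, hL, S.conc_self]
  have htJ : J.trace = n * k := by
    simp [Matrix.trace, hJ]
  have hF : S.infoMatrix = 1 - ((n : ℝ) * k)⁻¹ • L := rfl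
  have hc : ((n : ℝ) * k)⁻¹ * (μ * n) = 1 / ((n : ℝ) - 1) := by
    rw [hkr]; field_simp
  have hcc : ((n : ℝ) * k)⁻¹ * (n * k) = 1 := by field_simp
  have hlast : (((n * k - 1 - (n - 1) ^ 2 : ℕ)) : ℝ) = n * k - 1 - ((n : ℝ) - 1) ^ 2 := by
    rw [Nat.cast_sub (by omega), Nat.cast_sub (by omega)]
    push_cast [Nat.cast_sub (by omega : 1 ≤ n)]; ring
  have hsq : (((n - 1) ^ 2 : ℕ) : ℝ) = ((n : ℝ) - 1) ^ 2 := by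
    push_cast [Nat.cast_sub (by omega : 1 ≤ n)]; ring
  have htr1 : (1 : Matrix (Fin (n * k)) (Fin (n * k)) ℝ).trace = n * k := by
    simp [Matrix.trace_one]
  apply aux_spec_s2
  · rw [hF]
    ext α β
    simp only [Matrix.conjTranspose_apply, Matrix.sub_apply, Matrix.smul_apply, hL, Matrix.of_apply,
      star_trivial, S.conc_symm α β, Matrix.one_apply, eq_comm]
  · have : 1 / ((n : ℝ) - 1) < 1 := by rw [div_lt_one] <;> linarith
    linarith
  · have : 0 < 1 / ((n : ℝ) - 1) := by apply one_div_pos.2; linarith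
    linarith
  · simp only [Fintype.card_fin]; omega
  · rw [hF, Matrix.trace_sub, Matrix.trace_smul, htL, htr1, hlast, hsq, smul_eq_mul]
    field_simp
    ring
  · have e : (1 - ((n : ℝ) * k)⁻¹ • L) * (1 - ((n : ℝ) * k)⁻¹ • L) =
        1 - (2 * ((n : ℝ) * k)⁻¹) • L + (((n : ℝ) * k)⁻¹ * ((n : ℝ) * k)⁻¹) • (L * L) := by
      simp only [sub_mul, mul_sub, one_mul, mul_one, smul_mul_assoc, mul_smul_comm, smul_smul]
      module
    rw [hF, e, hLL]
    simp only [Matrix.trace_sub, Matrix.trace_add, Matrix.trace_smul, htL, htr1, hlast, hsq,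
      smul_eq_mul, htJ]
    rw [hkr]
    field_simp
    ring
  · rw [hF]
    have e1 : (1 - ((n : ℝ) * k)⁻¹ • L - (1 - 1 / ((n : ℝ) - 1)) • 1) *
        (1 - ((n : ℝ) * k)⁻¹ • L - 1) =
        (((n : ℝ) * k)⁻¹ * ((n : ℝ) * k)⁻¹ * ((μ : ℝ) * (n ^ 2 - 2 * n))) • J := by
      have : (1 - ((n : ℝ) * k)⁻¹ • L - (1 - 1 / ((n : ℝ) - 1)) • 1) *
        (1 - ((n : ℝ) * k)⁻¹ • L - 1) = (((n : ℝ) * k)⁻¹ * ((n : ℝ) * k)⁻¹) • (L * L)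
          - (((n : ℝ) * k)⁻¹ * (1 / ((n : ℝ) - 1))) • L := by
        simp only [sub_mul, mul_sub, one_mul, mul_one, smul_mul_assoc, mul_smul_comm, smul_smul]
        module
      rw [this, hLL, ← hc]
      module
    rw [e1, mul_smul_comm, sub_mul, one_mul, smul_mul_assoc, hLJ, smul_smul, hcc, one_smul,
      sub_self, smul_zero]
end

section
/- Let n > 2 and let S be a uniform (n×n)/k semi-Latin square. Then S is Schur optimal; that is, the underlying block design of S is Schur optimal in the class of underlying block designs of all (n×n)/k semi-Latin squares on the same treatment set. -/
open Polynomial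

namespace SLSAux

open Matrix

lemma spec {v : ℕ} (A : Matrix (Fin v) (Fin v) ℝ) (hA : A.IsHermitian) :
    ∃ (d : Fin v → ℝ) (U : Matrix (Fin v) (Fin v) ℝ), U * Uᵀ = 1 ∧ Uᵀ * U = 1 ∧
      A = U * diagonal d * Uᵀ ∧ A.charpoly.roots = Finset.univ.val.map d := by
  refine ⟨hA.eigenvalues, hA.eigenvectorUnitary, ?_, ?_, ?_, ?_⟩
  · have := Unitary.coe_mul_star_self hA.eigenvectorUnitary
    simpa [star_eq_conjTranspose] using this
  · have := Unitary.coe_star_mul_self hA.eigenvectorUnitary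
    simpa [star_eq_conjTranspose] using this
  · have := hA.spectral_theorem
    rw [Unitary.conjStarAlgAut_apply] at this
    simpa [star_eq_conjTranspose, Function.comp_def] using this
  · simpa [Function.comp_def] using hA.roots_charpoly_eq_eigenvalues

/-- spectral facts about `1 - c • N Nᵀ`. -/
lemma specFacts {v : ℕ} {P : Type*} [Fintype P] (N : Matrix (Fin v) P ℝ) (c : ℝ) (hc : 0 ≤ c)
    (F : Matrix (Fin v) (Fin v) ℝ) (hF : F = 1 - c • (N * Nᵀ)) :
    ∃ d : Fin v → ℝ, F.charpoly.roots = Finset.univ.val.map d ∧ (∀ i, d i ≤ 1) ∧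
      (∑ i, (1 - d i) = c * (N * Nᵀ).trace) ∧
      (∑ i, (1 - d i) ^ 2 = c ^ 2 * ((Nᵀ * N) * (Nᵀ * N)).trace) ∧
      (Finset.univ.filter fun i => d i ≠ 1).card ≤ N.rank := by
  have hA : F.IsHermitian := by
    rw [hF, IsHermitian, conjTranspose_eq_transpose_of_trivial]
    simp [transpose_mul]
  obtain ⟨d, U, h1, h2, h3, h4⟩ := spec F hA
  have hG : c • (N * Nᵀ) = U * diagonal (fun i => 1 - d i) * Uᵀ := by
    have e : diagonal (fun i => 1 - d i) = 1 - diagonal d := by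
      rw [← diagonal_one, diagonal_sub]
    rw [e, mul_sub, sub_mul, mul_one, h1, ← h3, hF]; simp
  have hD : diagonal (fun i => 1 - d i) = (Uᵀ * (c • (N * Nᵀ))) * U := by
    rw [hG]
    calc _ = (Uᵀ * U) * diagonal (fun i => 1 - d i) * (Uᵀ * U) := by rw [h2]; simp
      _ = _ := by simp only [Matrix.mul_assoc]
  refine ⟨d, h4, ?_, ?_, ?_, ?_⟩
  · intro i
    have hi : 1 - d i = c * ∑ p, ((Uᵀ * N) i p) ^ 2 := by
      have e : diagonal (fun i => 1 - d i) = c • ((Uᵀ * N) * (Uᵀ * N)ᵀ) := by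
        rw [hD]; simp [transpose_mul, Matrix.mul_assoc]
      have := congrFun (congrFun e i) i
      rw [diagonal_apply_eq] at this
      rw [this, Matrix.smul_apply, Matrix.mul_apply]
      simp [pow_two]
    have : 0 ≤ c * ∑ p, ((Uᵀ * N) i p) ^ 2 := by positivity
    linarith
  · rw [← smul_eq_mul, ← trace_smul, hG, trace_mul_cycle, h2, one_mul, trace_diagonal]
  · have e : (c • (N * Nᵀ)) * (c • (N * Nᵀ)) =
        U * diagonal (fun i => (1 - d i) ^ 2) * Uᵀ := by
      rw [hG]
      calc _ = U * diagonal (fun i => 1 - d i) * (Uᵀ * U) * diagonal (fun i => 1 - d i) * Uᵀ := by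
            simp only [Matrix.mul_assoc]
        _ = _ := by
            rw [h2, mul_one, Matrix.mul_assoc U, diagonal_mul_diagonal]
            simp only [pow_two]
    have e2 := congrArg trace e
    rw [trace_mul_cycle, h2, one_mul, trace_diagonal] at e2
    rw [← e2]
    simp only [Matrix.smul_mul, Matrix.mul_smul, trace_smul, smul_eq_mul]
    rw [Matrix.mul_assoc N, trace_mul_comm N]
    simp only [Matrix.mul_assoc]
    ring
  · have r1 : (diagonal (fun i => 1 - d i)).rank ≤ N.rank := by
      rw [hD]
      refine (rank_mul_le_left _ _).trans ((rank_mul_le_right _ _).trans ?_)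
      rw [← Matrix.smul_mul]
      have : (c • N) * Nᵀ = N * (c • Nᵀ) := by simp
      rw [this]
      exact rank_mul_le_left _ _
    rw [rank_diagonal, Fintype.card_subtype] at r1
    refine le_trans (Finset.card_le_card ?_) r1
    intro i
    simp only [Finset.mem_filter, Finset.mem_univ, true_and]
    intro h h'
    exact h (by linarith)

/-- incidence matrix -/
noncomputable def inc {n k : ℕ} (T : SemiLatinSquare n k) :
    Matrix (Fin (n * k)) (Fin n × Fin n) ℝ :=
  Matrix.of fun α p => if α ∈ T.block p.1 p.2 then 1 else 0

lemma inc_mul {n k : ℕ} (T : SemiLatinSquare n k) :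
    inc T * (inc T)ᵀ = Matrix.of (fun α β => (T.concurrence α β : ℝ)) := by
  ext α β
  simp only [inc, Matrix.mul_apply, Matrix.transpose_apply, Matrix.of_apply,
    SemiLatinSquare.concurrence, Finset.card_filter]
  push_cast
  refine Finset.sum_congr rfl fun p _ => ?_
  by_cases h1 : α ∈ T.block p.1 p.2 <;> by_cases h2 : β ∈ T.block p.1 p.2 <;> simp [h1, h2]

lemma inc_mul' {n k : ℕ} (T : SemiLatinSquare n k) (p q : Fin n × Fin n) :
    ((inc T)ᵀ * inc T) p q = ((T.block p.1 p.2 ∩ T.block q.1 q.2).card : ℝ) := by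
  simp only [inc, Matrix.mul_apply, Matrix.transpose_apply, Matrix.of_apply]
  rw [← Finset.filter_univ_mem (T.block p.1 p.2 ∩ T.block q.1 q.2), Finset.card_filter]
  push_cast
  refine Finset.sum_congr rfl fun α _ => ?_
  by_cases h1 : α ∈ T.block p.1 p.2 <;> by_cases h2 : α ∈ T.block q.1 q.2 <;> simp [h1, h2]

lemma blk_sum {n k : ℕ} (T : SemiLatinSquare n k) (p : Fin n × Fin n) :
    ∑ α, inc T α p = (k : ℝ) := by
  have h : ((T.block p.1 p.2).card : ℝ) = k := by rw [T.blockSize]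
  rw [← h]
  simp [inc]

lemma row_sum {n k : ℕ} (T : SemiLatinSquare n k) (i : Fin n) (α : Fin (n * k)) :
    ∑ j, inc T α (i, j) = 1 := by
  obtain ⟨j, hj, hu⟩ := T.row_once i α
  rw [Finset.sum_eq_single j]
  · simp [inc, hj]
  · intro b _ hb
    simp only [inc, Matrix.of_apply, ite_eq_right_iff, one_ne_zero, imp_false]
    exact fun h => hb (hu b h)
  · simp

lemma col_sum {n k : ℕ} (T : SemiLatinSquare n k) (j : Fin n) (α : Fin (n * k)) :
    ∑ i, inc T α (i, j) = 1 := by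
  obtain ⟨i, hi, hu⟩ := T.col_once j α
  rw [Finset.sum_eq_single i]
  · simp [inc, hi]
  · intro b _ hb
    simp only [inc, Matrix.of_apply, ite_eq_right_iff, one_ne_zero, imp_false]
    exact fun h => hb (hu b h)
  · simp

lemma rank_inc {m k : ℕ} (T : SemiLatinSquare (m + 1) k) : (inc T).rank ≤ m * m + 1 := by
  let b : Option (Fin m × Fin m) → (Fin ((m + 1) * k) → ℝ) := fun o =>
    o.elim (fun _ => 1) (fun p α => inc T α (p.1.castSucc, p.2.castSucc))
  have hone : (fun _ => 1 : Fin ((m + 1) * k) → ℝ) ∈ Submodule.span ℝ (Set.range b) :=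
    Submodule.subset_span ⟨none, rfl⟩
  have h0 : ∀ i j : Fin m, (fun α => inc T α (i.castSucc, j.castSucc)) ∈
      Submodule.span ℝ (Set.range b) := fun i j => Submodule.subset_span ⟨some (i, j), rfl⟩
  have h1 : ∀ (i : Fin m) (j : Fin (m + 1)), (fun α => inc T α (i.castSucc, j)) ∈
      Submodule.span ℝ (Set.range b) := by
    intro i j
    refine Fin.lastCases ?_ (fun j => h0 i j) j
    have e : (fun α => inc T α (i.castSucc, Fin.last m)) =
        (fun _ => 1) - ∑ j : Fin m, (fun α => inc T α (i.castSucc, j.castSucc)) := by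
      ext α
      have := row_sum T i.castSucc α
      rw [Fin.sum_univ_castSucc] at this
      simp only [Pi.sub_apply, Finset.sum_apply]
      linarith
    rw [e]
    exact Submodule.sub_mem _ hone (Submodule.sum_mem _ fun j _ => h0 i j)
  have h2 : ∀ (i j : Fin (m + 1)), (fun α => inc T α (i, j)) ∈
      Submodule.span ℝ (Set.range b) := by
    intro i j
    refine Fin.lastCases ?_ (fun i => h1 i j) i
    have e : (fun α => inc T α (Fin.last m, j)) =
        (fun _ => 1) - ∑ i : Fin m, (fun α => inc T α (i.castSucc, j)) := by
      ext α
      have := col_sum T j α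
      rw [Fin.sum_univ_castSucc] at this
      simp only [Pi.sub_apply, Finset.sum_apply]
      linarith
    rw [e]
    exact Submodule.sub_mem _ hone (Submodule.sum_mem _ fun i _ => h1 i j)
  rw [rank_eq_finrank_span_cols]
  have hle : Submodule.span ℝ (Set.range (inc T).col) ≤ Submodule.span ℝ (Set.range b) := by
    rw [Submodule.span_le]
    rintro _ ⟨p, rfl⟩
    exact h2 p.1 p.2
  refine (Submodule.finrank_mono hle).trans ((finrank_range_le_card b).trans ?_)
  simp

lemma trace_inc {n k : ℕ} (T : SemiLatinSquare n k) :
    (inc T * (inc T)ᵀ).trace = (n : ℝ) * n * k := by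
  rw [trace_mul_comm]
  simp only [trace, diag_apply, inc_mul', Finset.inter_self, T.blockSize]
  simp

lemma row_disj {n k : ℕ} (T : SemiLatinSquare n k) (i j j' : Fin n) (h : j ≠ j') :
    (T.block i j ∩ T.block i j').card = 0 := by
  rw [Finset.card_eq_zero, Finset.eq_empty_iff_forall_notMem]
  intro α hα
  rw [Finset.mem_inter] at hα
  exact h ((T.row_once i α).unique hα.1 hα.2)

lemma col_disj {n k : ℕ} (T : SemiLatinSquare n k) (i i' j : Fin n) (h : i ≠ i') :
    (T.block i j ∩ T.block i' j).card = 0 := by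
  rw [Finset.card_eq_zero, Finset.eq_empty_iff_forall_notMem]
  intro α hα
  rw [Finset.mem_inter] at hα
  exact h ((T.col_once j α).unique hα.1 hα.2)

lemma k_eq {m k μ : ℕ} (hm : 1 < m) (S : SemiLatinSquare (m + 1) k) (hS : S.UniformWith μ) :
    k = m * μ := by
  have e : ∑ j : Fin (m + 1), ((inc S)ᵀ * inc S) (0, 0) (Fin.last m, j) = k := by
    simp only [Matrix.mul_apply]
    rw [Finset.sum_comm]
    simp only [← Finset.mul_sum, row_sum, mul_one, Matrix.transpose_apply]
    exact blk_sum S (0, 0)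
  have hl : (0 : Fin (m + 1)) ≠ Fin.last m := by
    intro h
    have := congrArg Fin.val h
    simp at this
    omega
  simp only [inc_mul'] at e
  rw [Fin.sum_univ_succ, col_disj S _ _ _ hl] at e
  simp only [hS.2 _ _ _ _ hl (Fin.succ_ne_zero _).symm] at e
  simp at e
  exact_mod_cast e.symm

lemma trace_sq {m k μ : ℕ} (S : SemiLatinSquare (m + 1) k) (hS : S.UniformWith μ) :
    (((inc S)ᵀ * inc S) * ((inc S)ᵀ * inc S)).trace =
      ((m : ℝ) + 1) ^ 2 * ((k : ℝ) ^ 2 + (m : ℝ) ^ 2 * (μ : ℝ) ^ 2) := by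
  have key : ∀ p q : Fin (m + 1) × Fin (m + 1),
      ((inc S)ᵀ * inc S) p q * ((inc S)ᵀ * inc S) q p =
      (if p.1 = q.1 then (if p.2 = q.2 then (k : ℝ) ^ 2 else 0) else
        (if p.2 = q.2 then 0 else (μ : ℝ) ^ 2)) := by
    rintro ⟨i, j⟩ ⟨i', j'⟩
    rw [inc_mul', inc_mul', Finset.inter_comm (S.block (i', j').1 _)]
    dsimp only
    by_cases h1 : i = i' <;> by_cases h2 : j = j'
    · subst h1 h2; simp [S.blockSize, pow_two]
    · subst h1; simp [h2, row_disj S i j j' h2]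
    · subst h2; simp [h1, col_disj S i i' j h1]
    · simp [h1, h2, hS.2 i j i' j' h1 h2, pow_two]
  simp only [trace, diag_apply, Matrix.mul_apply (M := (inc S)ᵀ * inc S), key]
  have aux : ∀ (a b : ℝ) (i : Fin (m + 1)), ∑ i', (if i = i' then a else b) = a + m * b := by
    intro a b i
    have : ∀ i', (if i = i' then a else b) = (if i = i' then a - b else 0) + b := by
      intro i'; split_ifs <;> ring
    simp only [this, Finset.sum_add_distrib, Finset.sum_ite_eq]
    simp
    ring
  simp only [Fintype.sum_prod_type]
  have aux2 : ∀ (i j i' : Fin (m + 1)), ∑ j', (if i = i' then (if j = j' then (k : ℝ) ^ 2 else 0) else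
        (if j = j' then 0 else (μ : ℝ) ^ 2)) = if i = i' then (k : ℝ) ^ 2 else m * (μ : ℝ) ^ 2 := by
    intro i j i'
    by_cases h : i = i'
    · simp only [h, if_true, aux]; simp
    · simp only [h, if_false, aux]; simp
  simp only [aux2, aux]
  simp
  ring

lemma zero_root {n k : ℕ} (hn : 0 < n) (hk : 0 < k) (T : SemiLatinSquare n k) :
    (0 : ℝ) ∈ T.infoMatrix.charpoly.roots := by
  have hF : T.infoMatrix *ᵥ (fun _ => 1) = 0 := by
    have h1 : (inc T)ᵀ *ᵥ (fun _ => 1) = fun _ => (k : ℝ) := by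
      ext p
      have := blk_sum T p
      simpa [mulVec, dotProduct] using this
    have h2 : inc T *ᵥ (fun _ => (k : ℝ)) = fun _ => (n : ℝ) * k := by
      ext α
      simp only [mulVec, dotProduct, ← Finset.sum_mul, Fintype.sum_prod_type, row_sum]
      simp
    rw [SemiLatinSquare.infoMatrix, ← inc_mul, sub_mulVec, one_mulVec, smul_mulVec,
      ← mulVec_mulVec, h1, h2]
    ext α
    have : (n : ℝ) * k ≠ 0 := by positivity
    simp only [Pi.sub_apply, Pi.smul_apply, smul_eq_mul, Pi.zero_apply]
    rw [inv_mul_cancel₀ this, sub_self]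
  have hdet : T.infoMatrix.det = 0 := by
    apply Matrix.exists_mulVec_eq_zero_iff.mp
    refine ⟨fun _ => 1, ?_, hF⟩
    intro h
    have := congrFun h ⟨0, Nat.mul_pos hn hk⟩
    simp at this
  rw [Polynomial.mem_roots (Matrix.charpoly_monic _).ne_zero, Polynomial.IsRoot.def,
    Matrix.eval_charpoly]
  simp [Matrix.det_neg, hdet]

/-- facts on the efficiency factors -/
lemma effFacts {m k : ℕ} (hk : 0 < k) (T : SemiLatinSquare (m + 1) k) :
    (T.effFactors.card = (m + 1) * k - 1) ∧ (∀ x ∈ T.effFactors, x ≤ 1) ∧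
    ((T.effFactors.map fun x : ℝ => 1 - x).sum = (m : ℝ)) ∧
    (T.effFactors.countP (fun x => x ≠ 1) ≤ m * m) ∧
    ((T.effFactors.map fun x : ℝ => (1 - x) ^ 2).sum + 1 =
      ((((m + 1 : ℕ) : ℝ) * (k : ℝ))⁻¹) ^ 2 *
        (((inc T)ᵀ * inc T) * ((inc T)ᵀ * inc T)).trace) := by
  have hz := zero_root (Nat.succ_pos m) hk T
  obtain ⟨d, h1, h2, h3, h4, h5⟩ := specFacts (inc T) ((((m + 1 : ℕ) : ℝ) * (k : ℝ))⁻¹)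
    (by positivity) T.infoMatrix (by rw [inc_mul]; rfl)
  have hE : T.infoMatrix.charpoly.roots = 0 ::ₘ T.effFactors := (Multiset.cons_erase hz).symm
  rw [hE] at h1
  rw [trace_inc] at h3
  refine ⟨?_, ?_, ?_, ?_, ?_⟩
  · have := congrArg Multiset.card h1
    simp only [Multiset.card_cons, Multiset.card_map, Finset.card_val, Finset.card_univ, Fintype.card_fin] at this
    omega
  · intro x hx
    have : x ∈ Finset.univ.val.map d := h1 ▸ Multiset.mem_cons_of_mem hx
    obtain ⟨i, _, rfl⟩ := Multiset.mem_map.mp this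
    exact h2 i
  · have := congrArg (fun s => (Multiset.map (fun x : ℝ => 1 - x) s).sum) h1
    simp only [Multiset.map_cons, Multiset.sum_cons, Multiset.map_map, Function.comp_def] at this
    have e : (Multiset.map (fun x => 1 - d x) Finset.univ.val).sum = ∑ i, (1 - d i) := rfl
    rw [e, h3] at this
    have hk' : (k : ℝ) ≠ 0 := by positivity
    have hm' : (m : ℝ) + 1 ≠ 0 := by positivity
    push_cast at this
    field_simp at this
    linarith
  · have := congrArg (Multiset.countP (fun x : ℝ => x ≠ 1)) h1
    rw [Multiset.countP_cons_of_pos _ (by norm_num), Multiset.countP_map] at this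
    have e : (Multiset.filter (fun a => d a ≠ 1) Finset.univ.val).card =
      (Finset.univ.filter fun i => d i ≠ 1).card := rfl
    rw [e] at this
    have := rank_inc T
    omega
  · have := congrArg (fun s => (Multiset.map (fun x : ℝ => (1 - x) ^ 2) s).sum) h1
    simp only [Multiset.map_cons, Multiset.sum_cons, Multiset.map_map, Function.comp_def] at this
    have e : (Multiset.map (fun x => (1 - d x) ^ 2) Finset.univ.val).sum = ∑ i, (1 - d i) ^ 2 := rfl
    rw [e, h4] at this
    rw [← this]
    ring

lemma eff_lower (E : Multiset ℝ) (m : ℕ) (hm : 0 < m)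
    (h1 : (E.map fun x : ℝ => 1 - x).sum = (m : ℝ))
    (h2 : (E.map fun x : ℝ => (1 - x) ^ 2).sum = 1)
    (h3 : E.countP (fun x => x ≠ 1) ≤ m * m) : ∀ x ∈ E, 1 - 1 / (m : ℝ) ≤ x := by
  have hm' : (0 : ℝ) < m := by positivity
  set δ : ℝ := 1 / (m : ℝ) with hδ
  have hδm : δ * m = 1 := by rw [hδ]; field_simp
  let g : ℝ → ℝ := fun x => (1 - x) ^ 2 - 2 * δ * (1 - x) + δ ^ 2 * (if x ≠ 1 then 1 else 0)
  have hg : ∀ x, 0 ≤ g x := by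
    intro x
    by_cases h : x = 1
    · simp [g, h]
    · have : g x = (1 - x - δ) ^ 2 := by simp [g, h]; ring
      rw [this]; positivity
  have hcount : (E.map fun x : ℝ => if x ≠ 1 then (1 : ℝ) else 0).sum
      = (E.countP (fun x => x ≠ 1) : ℝ) := by
    clear h1 h2 h3
    induction E using Multiset.induction_on with
    | empty => simp
    | cons a s ih =>
      rw [Multiset.map_cons, Multiset.sum_cons, ih, Multiset.countP_cons]
      push_cast
      split_ifs <;> ring
  have hsum : (E.map g).sum ≤ 0 := by
    have : (E.map g).sum = 1 - 2 * δ * m + δ ^ 2 * (E.countP (fun x => x ≠ 1) : ℝ) := by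
      simp only [g]
      rw [Multiset.sum_map_add, Multiset.sum_map_sub, Multiset.sum_map_mul_left,
        Multiset.sum_map_mul_left, h2, hcount]
      have h1' : (Multiset.map (HSub.hSub (1 : ℝ)) E).sum = m := h1
      rw [h1']
    rw [this]
    have h3' : (E.countP (fun x => x ≠ 1) : ℝ) ≤ m * m := by exact_mod_cast h3
    have : δ ^ 2 * (E.countP (fun x => x ≠ 1) : ℝ) ≤ δ ^ 2 * (m * m) := by gcongr
    nlinarith
  intro x hx
  have hle : g x ≤ (E.map g).sum := by
    apply Multiset.single_le_sum
    · intro y hy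
      obtain ⟨z, _, rfl⟩ := Multiset.mem_map.mp hy
      exact hg z
    · exact Multiset.mem_map_of_mem g hx
  have hgx : g x = 0 := le_antisymm (hle.trans hsum) (hg x)
  by_cases h : x = 1
  · rw [h]; linarith [show 0 ≤ δ by positivity]
  · have e : g x = (1 - x - δ) ^ 2 := by simp [g, h]; ring
    rw [e] at hgx
    have := pow_eq_zero_iff (two_ne_zero) |>.mp hgx
    linarith

lemma sum_le_len (L : List ℝ) (c : ℝ) (h : ∀ x ∈ L, x ≤ c) : L.sum ≤ L.length * c := by
  simpa using List.sum_le_card_nsmul L c h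

lemma len_le_sum (L : List ℝ) (c : ℝ) (h : ∀ x ∈ L, c ≤ x) : L.length * c ≤ L.sum := by
  simpa using List.card_nsmul_le_sum L c h

lemma split_sum (L : List ℝ) (l : ℕ) : L.sum = (L.take l).sum + (L.drop l).sum := by
  rw [← List.sum_append, List.take_append_drop]

lemma drop_one (L : List ℝ) (M : ℕ) (hs : L.Pairwise (· ≤ ·)) (h1 : ∀ x ∈ L, x ≤ 1)
    (hM : M ≤ L.length) (hc : L.countP (fun x => x ≠ 1) ≤ M) : ∀ x ∈ L.drop M, x = 1 := by
  intro x hx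
  by_contra hne
  have hx1 : x < 1 := lt_of_le_of_ne (h1 x (List.mem_of_mem_drop hx)) hne
  rw [← List.take_append_drop M L, List.pairwise_append] at hs
  have ht : ∀ a ∈ L.take M, a ≠ 1 := fun a ha => ((hs.2.2 a ha x hx).trans_lt hx1).ne
  rw [← List.take_append_drop M L, List.countP_append] at hc
  have e1 : (L.take M).countP (fun x => x ≠ 1) = (L.take M).length := by
    rw [List.countP_eq_length]
    intro a ha; simpa using ht a ha
  have e2 : 0 < (L.drop M).countP (fun x => x ≠ 1) := by
    rw [List.countP_pos_iff]
    exact ⟨x, hx, by simpa using hne⟩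
  rw [List.length_take] at e1
  omega

lemma take_le (L : List ℝ) (c : ℝ) (hs : L.Pairwise (· ≤ ·)) (hc : L.sum = L.length * c) (l : ℕ)
    (hl : l ≤ L.length) : (L.take l).sum ≤ l * c := by
  by_cases h : ∀ x ∈ L.take l, x ≤ c
  · have := sum_le_len _ _ h
    rwa [List.length_take, min_eq_left hl] at this
  · push Not at h
    obtain ⟨x, hx, hcx⟩ := h
    rw [← List.take_append_drop l L, List.pairwise_append] at hs
    have := len_le_sum (L.drop l) c (fun y hy => (hcx.trans_le (hs.2.2 x hx y hy)).le)
    rw [List.length_drop, Nat.cast_sub hl] at this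
    have := split_sum L l
    linarith

lemma main_list (A B : List ℝ) (M : ℕ) (c s : ℝ) (len : ℕ)
    (hA : A.Pairwise (· ≤ ·)) (hAl : A.length = len) (hBl : B.length = len)
    (hA1 : ∀ x ∈ A, x ≤ 1) (hB1 : ∀ x ∈ B, x ≤ 1) (hBc : ∀ x ∈ B, c ≤ x)
    (hM : M ≤ len) (hcount : A.countP (fun x => x ≠ 1) ≤ M)
    (hAs : A.sum = s) (hBs : B.sum = s) (hs : s = M * c + (len - M)) (l : ℕ) (hl : l ≤ len) :
    (A.take l).sum ≤ (B.take l).sum := by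
  have hd := drop_one A M hA hA1 (hAl ▸ hM) hcount
  rcases le_total l M with h | h
  · have b := len_le_sum (B.take l) c (fun x hx => hBc x (List.mem_of_mem_take hx))
    rw [List.length_take, hBl, min_eq_left hl] at b
    have hsum : (A.take M).sum = (A.take M).length * c := by
      have h1 := len_le_sum (A.drop M) 1 (fun x hx => (hd x hx).ge)
      have h2 := sum_le_len (A.drop M) 1 (fun x hx => (hd x hx).le)
      have h3 := split_sum A M
      rw [List.length_drop, hAl, Nat.cast_sub hM] at h1 h2
      rw [List.length_take, hAl, min_eq_left hM]
      linarith
    have := take_le (A.take M) c (hA.sublist (List.take_sublist _ _)) hsum l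
      (by rw [List.length_take, hAl, min_eq_left hM]; exact h)
    rw [List.take_take, min_eq_left h] at this
    linarith
  · have h1 := len_le_sum (A.drop l) 1 (fun x hx => (hd x (by
      have : A.drop l = (A.drop M).drop (l - M) := by rw [List.drop_drop]; congr 1; omega
      rw [this] at hx
      exact List.mem_of_mem_drop hx)).ge)
    have h2 := sum_le_len (B.drop l) 1 (fun x hx => hB1 x (List.mem_of_mem_drop hx))
    rw [List.length_drop, hAl] at h1
    rw [List.length_drop, hBl] at h2
    have h3 := split_sum A l
    have h4 := split_sum B l
    linarith

lemma sum_of (E : Multiset ℝ) (s : ℝ) (h : (E.map fun x : ℝ => 1 - x).sum = s) :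
    E.sum = E.card - s := by
  rw [Multiset.sum_map_sub] at h
  simp at h
  linarith

end SLSAux

/-- (Soicher) A uniform `(n×n)/k` semi-Latin square (`n > 2`) is Schur optimal in the
class of all `(n×n)/k` semi-Latin squares on the same treatment set. -/
theorem uniform_sls_schur_optimal (n k : ℕ) (hn : 2 < n) (hk : 0 < k)
    (S : SemiLatinSquare n k) (hS : S.IsUniform) :
    S.SchurOptimal := by
  obtain ⟨μ, hμ⟩ := hS
  obtain ⟨m, rfl⟩ : ∃ m, n = m + 1 := ⟨n - 1, by omega⟩
  have hm : 1 < m := by omega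
  have hm' : (m : ℝ) ≠ 0 := by positivity
  have hkm := SLSAux.k_eq hm S hμ
  intro T l _ hl
  obtain ⟨a1, a2, a3, a4, -⟩ := SLSAux.effFacts hk T
  obtain ⟨b1, b2, b3, b4, b5⟩ := SLSAux.effFacts hk S
  have hsq : (S.effFactors.map fun x : ℝ => (1 - x) ^ 2).sum = 1 := by
    rw [SLSAux.trace_sq S hμ] at b5
    have e : (m : ℝ) ^ 2 * (μ : ℝ) ^ 2 = (k : ℝ) ^ 2 := by rw [hkm]; push_cast; ring
    rw [e] at b5
    have hk' : (k : ℝ) ≠ 0 := by positivity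
    have hm1 : (m : ℝ) + 1 ≠ 0 := by positivity
    push_cast at b5
    field_simp at b5
    linarith
  have hlow := SLSAux.eff_lower S.effFactors m (by omega) b3 hsq b4
  have hmu : 0 < μ := hμ.1
  have hM : m * m + 1 ≤ (m + 1) * k := by
    rw [hkm]
    nlinarith [Nat.mul_le_mul_left ((m + 1) * m) hmu]
  have hAs := SLSAux.sum_of _ _ a3
  have hBs := SLSAux.sum_of _ _ b3
  rw [a1] at hAs
  rw [b1] at hBs
  have cs : ∀ E : Multiset ℝ, ((E.sort (· ≤ ·) : List ℝ) : Multiset ℝ) = E :=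
    fun E => Multiset.sort_eq _ _
  refine SLSAux.main_list T.sortedEff S.sortedEff (m * m) (1 - 1 / (m : ℝ))
    (((m + 1) * k - 1 : ℕ) - (m : ℝ)) ((m + 1) * k - 1) ?_ ?_ ?_ ?_ ?_ ?_ (by omega) ?_ ?_ ?_ ?_ l hl
  · exact Multiset.pairwise_sort _ _
  · rw [← a1]; exact Multiset.length_sort _
  · rw [← b1]; exact Multiset.length_sort _
  · intro x hx; exact a2 x ((Multiset.mem_sort _).mp hx)
  · intro x hx; exact b2 x ((Multiset.mem_sort _).mp hx)
  · intro x hx; exact hlow x ((Multiset.mem_sort _).mp hx)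
  · rw [← cs T.effFactors, Multiset.coe_countP] at a4
    exact a4
  · rw [← hAs]
    conv_rhs => rw [← cs T.effFactors, Multiset.sum_coe]
    rfl
  · rw [← hBs]
    conv_rhs => rw [← cs S.effFactors, Multiset.sum_coe]
    rfl
  · push_cast
    field_simp
    ring
end

section
/- Let n > 2 and k > 0 be integers, and suppose there exists a uniform (n×n)/k semi-Latin square. Then every Schur optimal (n×n)/k semi-Latin square is uniform; consequently, the Schur optimal (n×n)/k semi-Latin squares are precisely the uniform ones. -/
open Polynomial

theorem spec_aux {ι : Type*} [Fintype ι] [DecidableEq ι] (A : Matrix ι ι ℝ) (hA : A.PosSemidef) :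
    ∃ l : ι → ℝ, (1 - A).charpoly.roots = Finset.univ.val.map (fun i => 1 - l i) ∧
      A.trace = ∑ i, l i ∧ (A * A).trace = ∑ i, l i ^ 2 ∧
      A.rank = Fintype.card {i // l i ≠ 0} ∧ (∀ i, 0 ≤ l i) ∧ (1 - A).det = ∏ i, (1 - l i) := by
  have hH := hA.isHermitian
  set l := hH.eigenvalues with hl
  set U : Matrix ι ι ℝ := (hH.eigenvectorUnitary : Matrix ι ι ℝ) with hU
  have hUU : star U * U = 1 := Unitary.coe_star_mul_self _
  have hUU' : U * star U = 1 := Unitary.coe_mul_star_self _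
  have hsp : A = U * Matrix.diagonal l * star U := by
    have := hH.spectral_theorem
    rw [Unitary.conjStarAlgAut_apply] at this
    simpa using this
  have h1 : 1 - A = U * Matrix.diagonal (fun i => 1 - l i) * star U := by
    have : Matrix.diagonal (fun i => 1 - l i) = 1 - Matrix.diagonal l := by
      rw [← Matrix.diagonal_one, Matrix.diagonal_sub]
    rw [this, mul_sub, sub_mul, ← hsp, mul_one, hUU']
  refine ⟨l, ?_, ?_, ?_, hH.rank_eq_card_non_zero_eigs, hA.eigenvalues_nonneg, ?_⟩
  · rw [h1, Matrix.charpoly_mul_comm, ← mul_assoc, hUU, one_mul, Matrix.charpoly_diagonal,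
      Polynomial.roots_prod]
    · simp only [Polynomial.roots_X_sub_C, Multiset.bind_singleton]
    · exact Finset.prod_ne_zero_iff.mpr fun i _ => Polynomial.X_sub_C_ne_zero _
  · simpa using hH.trace_eq_sum_eigenvalues
  · have : A * A = U * (Matrix.diagonal l * Matrix.diagonal l) * star U := by
      calc A * A = U * Matrix.diagonal l * (star U * U) * Matrix.diagonal l * star U := by
            nth_rewrite 1 2 [hsp]; simp only [mul_assoc]
        _ = _ := by rw [hUU]; simp only [mul_assoc, one_mul]
    rw [this, Matrix.trace_mul_comm, ← mul_assoc, hUU, one_mul, Matrix.diagonal_mul_diagonal,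
      Matrix.trace_diagonal]
    simp [sq]
  · rw [h1, Matrix.det_mul_comm, ← mul_assoc, hUU, one_mul, Matrix.det_diagonal]

theorem eff_aux {ι : Type*} [Fintype ι] [DecidableEq ι] [Nonempty ι]
    (A : Matrix ι ι ℝ) (hA : A.PosSemidef) (h1 : A.mulVec 1 = 1) (d : ℕ) (hr : A.rank ≤ d + 1) :
    let R := (1 - A).charpoly.roots.erase 0
    R.card = Fintype.card ι - 1 ∧ (∀ x ∈ R, x ≤ 1) ∧ R.countP (fun x => x ≠ 1) ≤ d ∧
    (R.map (fun x => 1 - x)).sum = A.trace - 1 ∧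
    (R.map (fun x => (1 - x)^2)).sum = (A * A).trace - 1 := by
  obtain ⟨l, hroots, ht, ht2, hrk, hpos, hdet⟩ := spec_aux A hA
  have hd0 : (1 - A).det = 0 := by
    apply Matrix.exists_mulVec_eq_zero_iff.mp
    refine ⟨1, one_ne_zero, ?_⟩
    rw [Matrix.sub_mulVec, h1, Matrix.one_mulVec, sub_self]
  have hmem : (0:ℝ) ∈ (1 - A).charpoly.roots := by
    rw [hdet] at hd0
    obtain ⟨i, -, hi⟩ := Finset.prod_eq_zero_iff.mp hd0
    rw [hroots, Multiset.mem_map]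
    exact ⟨i, by simp, hi⟩
  intro R
  have hcons : (0:ℝ) ::ₘ R = Finset.univ.val.map (fun i => 1 - l i) := by
    rw [← hroots]; exact Multiset.cons_erase hmem
  refine ⟨?_, ?_, ?_, ?_, ?_⟩
  · have := congrArg Multiset.card hcons
    simp at this
    omega
  · intro x hx
    have : x ∈ (0:ℝ) ::ₘ R := Multiset.mem_cons_of_mem hx
    rw [hcons, Multiset.mem_map] at this
    obtain ⟨i, -, rfl⟩ := this
    linarith [hpos i]
  · have := congrArg (Multiset.countP (fun x : ℝ => x ≠ 1)) hcons
    rw [Multiset.countP_cons_of_pos _ (by norm_num), Multiset.countP_map] at this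
    have h2 : Multiset.card (Multiset.filter (fun i => 1 - l i ≠ 1) Finset.univ.val) =
        Fintype.card {i // l i ≠ 0} := by
      rw [Fintype.card_subtype, ← Finset.filter_val, Finset.card_val]
      congr 1; ext i; simp
    omega
  · have := congrArg (fun s => (Multiset.map (fun x : ℝ => 1 - x) s).sum) hcons
    simp at this
    rw [ht]; linarith
  · have := congrArg (fun s => (Multiset.map (fun x : ℝ => (1 - x)^2) s).sum) hcons
    simp at this
    rw [ht2]; linarith

theorem take_aux (L : List ℝ) (l : ℕ) (hl : l ≤ L.length) :
    (L.take l).sum = ∑ i ∈ Finset.range l, L.getD i 1 := by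
  induction l with
  | zero => simp
  | succ l ih =>
    rw [Finset.sum_range_succ, ← ih (by omega), List.sum_take_succ _ _ (by omega)]
    rw [List.getD_eq_getElem _ _ (show l < L.length by omega)]

theorem sum_aux (L : List ℝ) (g : ℝ → ℝ) (hg : g 1 = 0) (l : ℕ) (hl : L.length ≤ l) :
    ∑ i ∈ Finset.range l, g (L.getD i 1) = (L.map g).sum := by
  induction L generalizing l with
  | nil => simp [hg]
  | cons a L ih =>
    obtain ⟨l, rfl⟩ : ∃ l', l = l' + 1 := ⟨l - 1, by simp at hl; omega⟩
    rw [Finset.sum_range_succ']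
    simp only [List.getD_cons_succ, List.getD_cons_zero, List.map_cons, List.sum_cons]
    rw [ih l (by simpa using hl)]; ring

theorem list_aux (L : List ℝ) (hs : L.Pairwise (· ≤ ·)) (h1 : ∀ x ∈ L, x ≤ 1) (d : ℕ)
    (hc : L.countP (fun x => x ≠ 1) ≤ d) :
    Monotone (fun i => L.getD i 1) ∧ (∀ i, d ≤ i → L.getD i 1 = 1) ∧
    ∀ g : ℝ → ℝ, g 1 = 0 → ∑ i ∈ Finset.range d, g (L.getD i 1) = (L.map g).sum := by
  have hle : ∀ i, L.getD i 1 ≤ 1 := by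
    intro i
    by_cases hi : i < L.length
    · rw [List.getD_eq_getElem _ _ hi]; exact h1 _ (List.getElem_mem _)
    · rw [List.getD_eq_default _ _ (by omega)]
  have hmono : Monotone (fun i => L.getD i 1) := by
    intro i j hij
    by_cases hj : j < L.length
    · show L.getD i 1 ≤ L.getD j 1
      rw [List.getD_eq_getElem _ _ hj, List.getD_eq_getElem _ _ (lt_of_le_of_lt hij hj)]
      rcases hij.eq_or_lt with rfl | h
      · exact le_rfl
      · exact List.pairwise_iff_getElem.mp hs _ _ _ _ h
    · show L.getD i 1 ≤ L.getD j 1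
      rw [List.getD_eq_default (n := j) _ _ (by omega)]; exact hle i
  have hd : ∀ i, d ≤ i → L.getD i 1 = 1 := by
    intro i hi
    by_contra hne
    have hil : i < L.length := by
      by_contra h
      exact hne (List.getD_eq_default _ _ (by omega))
    have hlt := lt_of_le_of_ne (hle i) hne
    have hall : (L.take (i+1)).countP (fun x => x ≠ 1) = (L.take (i+1)).length := by
      rw [List.countP_eq_length]
      intro a ha
      obtain ⟨j, hj, rfl⟩ := List.mem_iff_getElem.mp ha
      rw [List.length_take] at hj
      have := hmono (show j ≤ i by omega)
      simp only at this
      rw [List.getD_eq_getElem _ _ (show j < L.length by omega)] at this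
      simp only [List.getElem_take]
      simpa using (lt_of_le_of_lt this hlt).ne
    have h2 := (List.take_sublist (i+1) L).countP_le (p := fun x => decide (x ≠ 1))
    rw [hall, List.length_take] at h2
    omega
  refine ⟨hmono, hd, ?_⟩
  intro g hg
  rw [← sum_aux L g hg (d + L.length) (by omega), Finset.sum_range_add]
  simp only [left_eq_add]
  apply Finset.sum_eq_zero
  intro i _
  rw [hd _ (by omega), hg]

theorem fn_le (f : ℕ → ℝ) (hf : Monotone f) (m : ℕ) (hm : 0 < m)
    (h1 : ∀ i, m * m ≤ i → f i = 1)
    (hsum : ∑ i ∈ Finset.range (m * m), (1 - f i) = m) (l : ℕ) :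
    ∑ i ∈ Finset.range l, f i ≤ ∑ i ∈ Finset.range l, (if i < m * m then 1 - 1 / (m:ℝ) else 1) := by
  have hm' : (0:ℝ) < m := by exact_mod_cast hm
  have heq : ∑ i ∈ Finset.range (m * m), f i =
      ∑ i ∈ Finset.range (m * m), (if i < m * m then 1 - 1 / (m:ℝ) else 1) := by
    have : ∑ i ∈ Finset.range (m * m), (if i < m * m then 1 - 1 / (m:ℝ) else 1) =
      ∑ i ∈ Finset.range (m * m), (1 - 1 / (m:ℝ)) :=
      Finset.sum_congr rfl (fun i hi => if_pos (Finset.mem_range.mp hi))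
    rw [this]
    simp at hsum ⊢
    have : (m:ℝ) * m * (1 - (m:ℝ)⁻¹) = m * m - m := by field_simp
    linarith
  rcases le_total l (m * m) with hl | hl
  · by_cases hc : ∀ i < l, f i ≤ 1 - 1 / (m:ℝ)
    · apply Finset.sum_le_sum
      intro i hi
      have hi := Finset.mem_range.mp hi
      rw [if_pos (by omega)]; exact hc i hi
    · push Not at hc
      obtain ⟨j, hj, hfj⟩ := hc
      obtain ⟨e, he⟩ := Nat.exists_eq_add_of_le hl
      rw [he, Finset.sum_range_add, Finset.sum_range_add] at heq
      have : ∑ i ∈ Finset.range e, (if l + i < l + e then 1 - 1 / (m:ℝ) else 1) ≤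
          ∑ i ∈ Finset.range e, f (l + i) := by
        apply Finset.sum_le_sum
        intro i hi
        have hi := Finset.mem_range.mp hi
        rw [if_pos (by omega)]
        exact hfj.le.trans (hf (by omega))
      rw [he]
      linarith
  · obtain ⟨e, rfl⟩ := Nat.exists_eq_add_of_le hl
    rw [Finset.sum_range_add, Finset.sum_range_add, heq]
    apply le_of_eq
    congr 1
    apply Finset.sum_congr rfl
    intro i _
    rw [h1 _ (by omega), if_neg (by omega)]

theorem fn_iff (f : ℕ → ℝ) (hf : Monotone f) (m : ℕ) (hm : 0 < m)
    (h1 : ∀ i, m * m ≤ i → f i = 1)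
    (hsum : ∑ i ∈ Finset.range (m * m), (1 - f i) = m) :
    (∑ i ∈ Finset.range (m * m), (1 - f i)^2 = 1 →
      ∀ i, f i = (if i < m * m then 1 - 1 / (m:ℝ) else 1)) ∧
    (1 - 1 / (m:ℝ) ≤ f 0 → ∑ i ∈ Finset.range (m * m), (1 - f i)^2 = 1) := by
  have hm' : (0:ℝ) < m := by exact_mod_cast hm
  constructor
  · intro h2
    have h0 : ∑ i ∈ Finset.range (m * m), (1 - f i - 1 / (m:ℝ))^2 = 0 := by
      have : ∀ i, (1 - f i - 1 / (m:ℝ))^2 =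
          (1 - f i)^2 - (2 / (m:ℝ)) * (1 - f i) + 1 / ((m:ℝ) * m) := by
        intro i; field_simp; ring
      simp only [this]
      rw [Finset.sum_add_distrib, Finset.sum_sub_distrib, ← Finset.mul_sum, h2, hsum]
      simp
      field_simp; norm_num
    rw [Finset.sum_eq_zero_iff_of_nonneg (fun i _ => sq_nonneg _)] at h0
    intro i
    split_ifs with h
    · have := pow_eq_zero_iff (two_ne_zero) |>.mp (h0 i (Finset.mem_range.mpr h))
      linarith
    · exact h1 i (by omega)
  · intro h0
    have hz : ∑ i ∈ Finset.range (m * m), (1 / (m:ℝ) - (1 - f i)) = 0 := by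
      rw [Finset.sum_sub_distrib, hsum]
      simp
    rw [Finset.sum_eq_zero_iff_of_nonneg
      (fun i _ => by have := hf (Nat.zero_le i); linarith)] at hz
    have : ∑ i ∈ Finset.range (m * m), (1 - f i)^2 = ∑ i ∈ Finset.range (m * m), (1 / (m:ℝ))^2 :=
      Finset.sum_congr rfl (fun i hi => by rw [show 1 - f i = 1 / (m:ℝ) by linarith [hz i hi]])
    rw [this]
    simp
    field_simp

namespace SemiLatinSquare

/-- incidence matrix -/
noncomputable def inc {n k : ℕ} (S : SemiLatinSquare n k) :
    Matrix (Fin (n * k)) (Fin n × Fin n) ℝ :=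
  Matrix.of fun α p => if α ∈ S.block p.1 p.2 then 1 else 0

/-- block intersection numbers -/
noncomputable def M {n k : ℕ} (S : SemiLatinSquare n k) (p q : Fin n × Fin n) : ℝ :=
  ((S.block p.1 p.2 ∩ S.block q.1 q.2).card : ℝ)

theorem inc_row {n k : ℕ} (S : SemiLatinSquare n k) (α : Fin (n * k)) (i : Fin n) :
    ∑ j, S.inc α (i, j) = 1 := by
  obtain ⟨j, hj, hu⟩ := S.row_once i α
  rw [Finset.sum_eq_single j]
  · simp [inc, hj]
  · intro b _ hb
    simp only [inc, Matrix.of_apply]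
    rw [if_neg]
    exact fun h => hb (hu b h)
  · simp

theorem inc_col {n k : ℕ} (S : SemiLatinSquare n k) (α : Fin (n * k)) (j : Fin n) :
    ∑ i, S.inc α (i, j) = 1 := by
  obtain ⟨i, hi, hu⟩ := S.col_once j α
  rw [Finset.sum_eq_single i]
  · simp [inc, hi]
  · intro b _ hb
    simp only [inc, Matrix.of_apply]
    rw [if_neg]
    exact fun h => hb (hu b h)
  · simp

theorem inc_sum {n k : ℕ} (S : SemiLatinSquare n k) (p : Fin n × Fin n) :
    ∑ α, S.inc α p = k := by
  simp [inc, S.blockSize]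

theorem M_eq {n k : ℕ} (S : SemiLatinSquare n k) (p q : Fin n × Fin n) :
    S.M p q = ∑ α, S.inc α p * S.inc α q := by
  simp only [M, inc, Matrix.of_apply, mul_ite, mul_one, mul_zero, ← ite_and]
  rw [Finset.sum_boole]
  congr 2
  ext α
  simp [and_comm]

theorem gram_eq {n k : ℕ} (S : SemiLatinSquare n k) :
    Matrix.of (fun α β => (S.concurrence α β : ℝ)) = S.inc * S.inc.transpose := by
  ext α β
  simp only [concurrence, Matrix.of_apply, Matrix.mul_apply, Matrix.transpose_apply, inc,
    mul_ite, mul_one, mul_zero, ← ite_and]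
  rw [Finset.sum_boole]
  congr 2
  ext p
  simp [and_comm]

theorem rank_inc {m k : ℕ} (S : SemiLatinSquare (m + 1) k) : S.inc.rank ≤ m * m + 1 := by
  classical
  rw [Matrix.rank_eq_finrank_span_cols]
  let b : Option (Fin m × Fin m) → (Fin ((m + 1) * k) → ℝ) := fun o =>
    match o with
    | none => 1
    | some p => S.inc.col (p.1.castSucc, p.2.castSucc)
  have hb := finrank_range_le_card (R := ℝ) b
  have hcard : Fintype.card (Option (Fin m × Fin m)) = m * m + 1 := by simp
  rw [hcard] at hb
  refine le_trans (Submodule.finrank_mono ?_) hb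
  have h1 : (1 : Fin ((m + 1) * k) → ℝ) ∈ Submodule.span ℝ (Set.range b) :=
    Submodule.subset_span ⟨none, rfl⟩
  have hcc : ∀ i j : Fin m, S.inc.col (i.castSucc, j.castSucc) ∈
      Submodule.span ℝ (Set.range b) := fun i j => Submodule.subset_span ⟨some (i, j), rfl⟩
  have hcl : ∀ i : Fin m, S.inc.col (i.castSucc, Fin.last m) ∈
      Submodule.span ℝ (Set.range b) := by
    intro i
    have : S.inc.col (i.castSucc, Fin.last m) =
        1 - ∑ j : Fin m, S.inc.col (i.castSucc, j.castSucc) := by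
      ext α
      have := S.inc_row α i.castSucc
      rw [Fin.sum_univ_castSucc] at this
      simp only [Pi.sub_apply, Pi.one_apply, Finset.sum_apply, Matrix.col_apply]
      linarith
    rw [this]
    exact Submodule.sub_mem _ h1 (Submodule.sum_mem _ fun j _ => hcc i j)
  have hl : ∀ j : Fin (m + 1), S.inc.col (Fin.last m, j) ∈ Submodule.span ℝ (Set.range b) := by
    intro j
    have : S.inc.col (Fin.last m, j) = 1 - ∑ i : Fin m, S.inc.col (i.castSucc, j) := by
      ext α
      have := S.inc_col α j
      rw [Fin.sum_univ_castSucc] at this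
      simp only [Pi.sub_apply, Pi.one_apply, Finset.sum_apply, Matrix.col_apply]
      linarith
    rw [this]
    refine Submodule.sub_mem _ h1 (Submodule.sum_mem _ fun i _ => ?_)
    refine Fin.lastCases ?_ (fun j => ?_) j
    · exact hcl i
    · exact hcc i j
  rw [Submodule.span_le]
  rintro _ ⟨⟨i, j⟩, rfl⟩
  refine Fin.lastCases ?_ (fun i => ?_) i
  · exact hl j
  · refine Fin.lastCases ?_ (fun j => ?_) j
    · exact hcl i
    · exact hcc i j

theorem M_diag {n k : ℕ} (S : SemiLatinSquare n k) (p : Fin n × Fin n) : S.M p p = k := by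
  simp [M, S.blockSize]

theorem M_row {n k : ℕ} (S : SemiLatinSquare n k) (i j j' : Fin n) (h : j' ≠ j) :
    S.M (i, j) (i, j') = 0 := by
  simp only [M, Nat.cast_eq_zero, Finset.card_eq_zero]
  rw [← Finset.disjoint_iff_inter_eq_empty, Finset.disjoint_left]
  intro α h1 h2
  exact h ((S.row_once i α).unique h2 h1)

theorem M_col {n k : ℕ} (S : SemiLatinSquare n k) (i i' j : Fin n) (h : i' ≠ i) :
    S.M (i, j) (i', j) = 0 := by
  simp only [M, Nat.cast_eq_zero, Finset.card_eq_zero]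
  rw [← Finset.disjoint_iff_inter_eq_empty, Finset.disjoint_left]
  intro α h1 h2
  exact h ((S.col_once j α).unique h2 h1)

theorem M_sum {n k : ℕ} (S : SemiLatinSquare n k) (p : Fin n × Fin n) (i' : Fin n) :
    ∑ j', S.M p (i', j') = k := by
  simp only [M_eq]
  rw [Finset.sum_comm]
  simp only [← Finset.mul_sum, inc_row, mul_one, inc_sum]

/-- deviation from uniformity -/
noncomputable def dev {n k : ℕ} (S : SemiLatinSquare n k) (m : ℕ) (p q : Fin n × Fin n) : ℝ :=
  if q.1 = p.1 then 0 else if q.2 = p.2 then 0 else (S.M p q - k / m) ^ 2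

theorem Q_eq {m k : ℕ} (hm : 0 < m) (S : SemiLatinSquare (m + 1) k) :
    ∑ p, ∑ q, (S.M p q) ^ 2 = 2 * ((m + 1 : ℝ) * k) ^ 2 + ∑ p, ∑ q, S.dev m p q := by
  have hm' : (m : ℝ) ≠ 0 := by exact_mod_cast hm.ne'
  have key : ∀ (p : Fin (m+1) × Fin (m+1)) (i' : Fin (m+1)),
      ∑ j', (S.M p (i', j')) ^ 2 =
        (if i' = p.1 then (k:ℝ)^2 else (k:ℝ)^2 / m) + ∑ j', S.dev m p (i', j') := by
    rintro ⟨i, j⟩ i'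
    by_cases h : i' = i
    · subst h
      simp only [dev, if_true, Finset.sum_const_zero, add_zero]
      rw [Finset.sum_eq_single j]
      · rw [M_diag]
      · intro b _ hb; rw [M_row _ _ _ _ hb]; simp
      · simp
    · simp only [dev, if_neg h]
      have h1 := S.M_sum (i, j) i'
      have h0 := S.M_col i i' j h
      have hE : ∀ j', (if j' = j then (0:ℝ) else (S.M (i, j) (i', j') - k / m) ^ 2) =
          (S.M (i, j) (i', j')) ^ 2 - 2 * (k / m) * S.M (i, j) (i', j') + (k / m : ℝ) ^ 2
            - if j' = j then (k / m : ℝ) ^ 2 else 0 := by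
        intro j'
        split_ifs with hj
        · subst hj; rw [h0]; ring
        · ring
      simp only [hE]
      rw [Finset.sum_sub_distrib, Finset.sum_add_distrib, Finset.sum_sub_distrib,
        ← Finset.mul_sum, h1]
      simp
      field_simp
      ring
  have key2 : ∀ p : Fin (m+1) × Fin (m+1), ∑ q, (S.M p q) ^ 2 =
      2 * (k:ℝ) ^ 2 + ∑ q, S.dev m p q := by
    intro p
    rw [Fintype.sum_prod_type, Fintype.sum_prod_type]
    simp only [key]
    rw [Finset.sum_add_distrib]
    congr 1
    rw [Fintype.sum_eq_add_sum_compl p.1]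
    rw [if_pos rfl, Finset.sum_congr rfl (g := fun _ => (k:ℝ)^2 / m)
      (fun x hx => if_neg (by simpa using hx))]
    simp [Finset.card_compl]
    field_simp
    ring
  simp only [key2]
  rw [Finset.sum_add_distrib]
  simp
  ring

theorem dev_iff {m k : ℕ} (hm : 0 < m) (hk : 0 < k) (S : SemiLatinSquare (m + 1) k) :
    S.IsUniform ↔ ∑ p, ∑ q, S.dev m p q = 0 := by
  have hm' : (0 : ℝ) < m := by exact_mod_cast hm
  have hk' : (0 : ℝ) < k := by exact_mod_cast hk
  have hnn : ∀ p q, 0 ≤ S.dev m p q := by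
    intro p q; unfold dev; split_ifs <;> positivity
  have hz : ∑ p, ∑ q, S.dev m p q = 0 ↔ ∀ p q, S.dev m p q = 0 := by
    rw [Finset.sum_eq_zero_iff_of_nonneg (fun p _ => Finset.sum_nonneg fun q _ => hnn p q)]
    simp only [Finset.mem_univ, true_imp_iff]
    refine forall_congr' fun p => ?_
    rw [Finset.sum_eq_zero_iff_of_nonneg (fun q _ => hnn p q)]
    simp
  rw [hz]
  constructor
  · rintro ⟨μ, -, hμ⟩ ⟨i, j⟩ ⟨i', j'⟩
    unfold dev
    split_ifs with h1 h2
    · rfl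
    · rfl
    · have hs := S.M_sum (i, j) i'
      have hM : ∀ x, S.M (i, j) (i', x) = (μ:ℝ) - if x = j then (μ:ℝ) else 0 := by
        intro x
        split_ifs with hx
        · subst hx; rw [M_col _ _ _ _ h1]; ring
        · simp only [M]; rw [hμ _ _ _ _ (Ne.symm h1) (Ne.symm hx)]; ring
      simp only [hM] at hs
      rw [Finset.sum_sub_distrib] at hs
      simp at hs
      rw [hM, if_neg h2, ← hs]
      field_simp
      ring
  · intro h
    have hM : ∀ i j i' j' : Fin (m+1), i ≠ i' → j ≠ j' → S.M (i, j) (i', j') = k / m := by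
      intro i j i' j' h1 h2
      have := h (i, j) (i', j')
      simp only [dev] at this
      rw [if_neg h1.symm, if_neg h2.symm] at this
      have := pow_eq_zero_iff (two_ne_zero) |>.mp this
      linarith
    have h0 : (0 : Fin (m+1)) ≠ Fin.last m := by
      intro h; have := congrArg Fin.val h; simp at this; omega
    refine ⟨(S.block 0 0 ∩ S.block (Fin.last m) (Fin.last m)).card, ?_, ?_⟩
    · have := hM 0 0 _ _ h0 h0
      have h2 : (0:ℝ) < k / m := by positivity
      rw [← this] at h2
      simpa only [M, Nat.cast_pos] using h2
    · intro i j i' j' h1 h2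
      have := (hM i j i' j' h1 h2).trans (hM 0 0 _ _ h0 h0).symm
      simpa only [M, Nat.cast_inj] using this

theorem main_aux {m k : ℕ} (hm : 0 < m) (hk : 0 < k) (S : SemiLatinSquare (m + 1) k) :
    ∃ f : ℕ → ℝ, Monotone f ∧ (∀ i, m * m ≤ i → f i = 1) ∧
      ∑ i ∈ Finset.range (m * m), (1 - f i) = m ∧
      (S.IsUniform ↔ ∑ i ∈ Finset.range (m * m), (1 - f i) ^ 2 = 1) ∧
      ∀ l, l ≤ (m + 1) * k - 1 → (S.sortedEff.take l).sum = ∑ i ∈ Finset.range l, f i := by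
  have hm' : (0 : ℝ) < m := by exact_mod_cast hm
  have hk' : (0 : ℝ) < k := by exact_mod_cast hk
  have hne : Nonempty (Fin ((m + 1) * k)) := ⟨⟨0, by positivity⟩⟩
  set c : ℝ := (((m + 1 : ℕ) : ℝ) * (k : ℝ))⁻¹ with hc
  have hc0 : 0 ≤ c := by positivity
  have hck : c * ((m + 1 : ℝ) * k) = 1 := by
    rw [hc]; push_cast; field_simp
  set A : Matrix (Fin ((m + 1) * k)) (Fin ((m + 1) * k)) ℝ := c • (S.inc * S.inc.transpose) with hA
  have hF : S.infoMatrix = 1 - A := by rw [infoMatrix, gram_eq]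
  have hpsd : A.PosSemidef := by
    have := Matrix.posSemidef_self_mul_conjTranspose S.inc
    rw [Matrix.conjTranspose_eq_transpose_of_trivial] at this
    exact this.smul hc0
  have h1 : A.mulVec 1 = 1 := by
    rw [hA, Matrix.smul_mulVec, ← Matrix.mulVec_mulVec]
    have e1 : S.inc.transpose.mulVec 1 = fun _ => (k:ℝ) := by
      ext p
      simp only [Matrix.mulVec, dotProduct, Matrix.transpose_apply, Pi.one_apply, mul_one]
      exact S.inc_sum p
    rw [e1]
    ext α
    simp only [Pi.smul_apply, Matrix.mulVec, dotProduct, Pi.one_apply, smul_eq_mul]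
    rw [← Finset.sum_mul, Fintype.sum_prod_type]
    simp only [inc_row]
    simpa using hck
  have hr : A.rank ≤ m * m + 1 := by
    have : A = S.inc * (c • S.inc.transpose) := by rw [hA, Matrix.mul_smul]
    rw [this]
    exact (Matrix.rank_mul_le_left _ _).trans S.rank_inc
  have ht : A.trace = m + 1 := by
    rw [hA, Matrix.trace_smul, Matrix.trace_mul_comm, smul_eq_mul]
    have : (S.inc.transpose * S.inc).trace = ∑ p, S.M p p := by
      simp only [Matrix.trace, Matrix.diag, Matrix.mul_apply, Matrix.transpose_apply, M_eq]
    rw [this]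
    simp only [M_diag]
    simp
    linear_combination (m + 1 : ℝ) * hck
  have ht2 : (A * A).trace = c ^ 2 * ∑ p, ∑ q, (S.M p q) ^ 2 := by
    have e1 : A * A = c ^ 2 • (S.inc * (S.inc.transpose * S.inc * S.inc.transpose)) := by
      rw [hA]
      simp only [Matrix.smul_mul, Matrix.mul_smul, smul_smul, sq, Matrix.mul_assoc]
    have e2 : S.inc.transpose * S.inc = Matrix.of S.M := by
      ext p q
      simp only [Matrix.mul_apply, Matrix.transpose_apply, M_eq, Matrix.of_apply]
    rw [e1, Matrix.trace_smul, Matrix.trace_mul_comm, Matrix.mul_assoc, e2, smul_eq_mul]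
    congr 1
    simp only [Matrix.trace, Matrix.diag, Matrix.mul_apply, Matrix.of_apply]
    refine Finset.sum_congr rfl fun p _ => Finset.sum_congr rfl fun q _ => ?_
    have : S.M q p = S.M p q := by simp only [M, Finset.inter_comm]
    rw [this, sq]
  obtain ⟨r1, r2, r3, r4, r5⟩ := eff_aux A hpsd h1 (m * m) hr
  have hL : S.sortedEff = ((1 - A).charpoly.roots.erase 0).sort (· ≤ ·) := by
    rw [sortedEff, effFactors, hF]
  generalize (1 - A).charpoly.roots.erase 0 = R at *
  have hcoe : (S.sortedEff : Multiset ℝ) = R := by rw [hL]; exact Multiset.sort_eq _ _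
  have hpw : S.sortedEff.Pairwise (· ≤ ·) := by rw [hL]; exact Multiset.pairwise_sort _ _
  generalize S.sortedEff = L at *
  rw [← hcoe] at r1 r2 r3 r4 r5
  simp only [Multiset.coe_card, Multiset.mem_coe, Multiset.coe_countP, Multiset.map_coe,
    Multiset.sum_coe, Fintype.card_fin] at r1 r2 r3 r4 r5
  obtain ⟨f1, f2, f3⟩ := list_aux L hpw r2 (m * m) r3
  refine ⟨fun i => L.getD i 1, f1, f2, ?_, ?_, ?_⟩
  · rw [f3 (fun x => 1 - x) (by norm_num), r4, ht]; ring
  · rw [f3 (fun x => (1 - x)^2) (by norm_num), r5, ht2, Q_eq hm, dev_iff hm hk]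
    have e : c ^ 2 * (2 * ((m + 1 : ℝ) * k) ^ 2 + ∑ p, ∑ q, S.dev m p q) - 1 =
        1 + c ^ 2 * ∑ p, ∑ q, S.dev m p q := by
      linear_combination 2 * (c * ((m + 1 : ℝ) * k) + 1) * hck
    rw [e]
    have hcne : c ^ 2 ≠ 0 := by
      intro h
      have := pow_eq_zero_iff (two_ne_zero) |>.mp h
      rw [this] at hck; simp at hck
    simp [hcne]
  · intro l hl
    exact take_aux L l (by omega)

end SemiLatinSquare

/-- Theorem 2(2): if a uniform `(n×n)/k` semi-Latin square exists (`n > 2`), then the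
Schur optimal `(n×n)/k` semi-Latin squares are precisely the uniform ones. -/
theorem schur_optimal_sls_iff_uniform (n k : ℕ) (hn : 2 < n) (hk : 0 < k)
    (hex : ∃ U : SemiLatinSquare n k, U.IsUniform) :
    ∀ S : SemiLatinSquare n k, S.SchurOptimal ↔ S.IsUniform := by
  obtain ⟨m, rfl⟩ : ∃ m, n = m + 1 := ⟨n - 1, by omega⟩
  have hm : 0 < m := by omega
  obtain ⟨U, hU⟩ := hex
  intro S
  obtain ⟨f, f1, f2, f3, f4, f5⟩ := S.main_aux hm hk
  constructor
  · intro hS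
    rw [f4]
    apply (fn_iff f f1 m hm f2 f3).2
    obtain ⟨g, g1, g2, g3, g4, g5⟩ := U.main_aux hm hk
    have hg := (fn_iff g g1 m hm g2 g3).1 (g4.mp hU) 0
    have hl : 1 ≤ (m + 1) * k - 1 := by
      have : 3 * 1 ≤ (m + 1) * k := Nat.mul_le_mul hn hk
      omega
    have := hS U 1 le_rfl hl
    rw [f5 1 hl, g5 1 hl] at this
    simp only [Finset.sum_range_one] at this
    rw [hg, if_pos (by positivity)] at this
    exact this
  · intro hS T l _ hl
    obtain ⟨g, g1, g2, g3, g4, g5⟩ := T.main_aux hm hk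
    have hf := (fn_iff f f1 m hm f2 f3).1 (f4.mp hS)
    rw [f5 l hl, g5 l hl]
    simp only [hf]
    exact fn_le g g1 m hm g2 g3 l
end

section
/- Let Δ be a (v,b,r,k)-design with r > 1, and suppose there is a positive integer μ such that every pair of distinct non-disjoint blocks of Δ intersect in exactly μ treatments. Then η₀(Δ) ≥ v(v − k − (r−1)(k−μ))/2. -/
open Polynomial

theorem BlockDesign.conc_symm {v b r k : ℕ} (D : BlockDesign v b r k) (α β : Fin v) :
    D.concurrence α β = D.concurrence β α := by
  unfold BlockDesign.concurrence
  simp only [and_comm]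

theorem BlockDesign.two_eta {v b r k : ℕ} (hr : 1 < r) (D : BlockDesign v b r k) :
    ∑ α : Fin v, (Finset.univ.filter fun β => D.concurrence α β = 0).card = 2 * D.eta 0 := by
  have h1 : ∑ α : Fin v, (Finset.univ.filter fun β => D.concurrence α β = 0).card
      = (Finset.univ.filter fun p : Fin v × Fin v => D.concurrence p.1 p.2 = 0).card := by
    simp only [Finset.card_filter]
    rw [Fintype.sum_prod_type]
  have h2 : (Finset.univ.filter fun p : Fin v × Fin v =>
      p.2 < p.1 ∧ D.concurrence p.1 p.2 = 0).card = D.eta 0 := by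
    unfold BlockDesign.eta
    apply Finset.card_bij (fun p _ => (p.2, p.1))
    · intro p hp
      simp only [Finset.mem_filter, Finset.mem_univ, true_and] at hp ⊢
      exact ⟨hp.1, by rw [D.conc_symm]; exact hp.2⟩
    · rintro ⟨a, c⟩ _ ⟨d, e⟩ _ h
      simp only [Prod.mk.injEq] at h ⊢
      exact ⟨h.2, h.1⟩
    · rintro ⟨a, c⟩ hp
      simp only [Finset.mem_filter, Finset.mem_univ, true_and] at hp
      refine ⟨(c, a), ?_, rfl⟩
      simp only [Finset.mem_filter, Finset.mem_univ, true_and]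
      exact ⟨hp.1, by rw [D.conc_symm]; exact hp.2⟩
  have hself : ∀ α, D.concurrence α α = r := by
    intro α
    have := D.replication α
    simpa [BlockDesign.concurrence] using this
  rw [h1, two_mul]
  nth_rewrite 2 [← h2]
  unfold BlockDesign.eta
  rw [← Finset.card_union_of_disjoint]
  · congr 1
    ext ⟨a, c⟩
    simp only [Finset.mem_filter, Finset.mem_univ, true_and, Finset.mem_union]
    constructor
    · intro h
      rcases lt_trichotomy a c with hl | rfl | hl
      · exact Or.inl ⟨hl, h⟩
      · rw [hself] at h; omega
      · exact Or.inr ⟨hl, h⟩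
    · rintro (h | h) <;> exact h.2
  · rw [Finset.disjoint_left]
    rintro ⟨a, c⟩ h h'
    simp only [Finset.mem_filter, Finset.mem_univ, true_and] at h h'
    exact absurd h.1 (not_lt.mpr h'.1.le)

theorem BlockDesign.zero_count {v b r k μ : ℕ} (hr : 1 < r) (D : BlockDesign v b r k)
    (hint : ∀ j j' : Fin b, j ≠ j' → (D.blocks j ∩ D.blocks j').Nonempty →
      (D.blocks j ∩ D.blocks j').card = μ) (α : Fin v) :
    (v : ℚ) - (k : ℚ) - ((r : ℚ) - 1) * ((k : ℚ) - (μ : ℚ)) ≤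
      ((Finset.univ.filter fun β => D.concurrence α β = 0).card : ℚ) := by
  classical
  set S := Finset.univ.filter fun j => α ∈ D.blocks j with hS
  have hSr : S.card = r := D.replication α
  obtain ⟨j0, hj0⟩ : S.Nonempty := by rw [← Finset.card_pos]; omega
  have hα0 : α ∈ D.blocks j0 := by simpa [hS] using hj0
  have hcov : (Finset.univ : Finset (Fin v)) ⊆
      (Finset.univ.filter fun β => D.concurrence α β = 0) ∪ (D.blocks j0 ∪
        (S.erase j0).biUnion fun j => D.blocks j \ D.blocks j0) := by
    intro β _
    by_cases h : D.concurrence α β = 0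
    · simp [h]
    · obtain ⟨j, hj⟩ := Finset.card_pos.mp (Nat.pos_of_ne_zero h)
      simp only [Finset.mem_filter, Finset.mem_univ, true_and] at hj
      simp only [Finset.mem_union, Finset.mem_biUnion, Finset.mem_sdiff, Finset.mem_erase]
      by_cases hb : β ∈ D.blocks j0
      · exact Or.inr (Or.inl hb)
      · refine Or.inr (Or.inr ⟨j, ⟨?_, ?_⟩, hj.2, hb⟩)
        · rintro rfl; exact hb hj.2
        · simpa [hS] using hj.1
  have hc := (Finset.card_le_card hcov).trans ((Finset.card_union_le _ _).trans
    (Nat.add_le_add_left ((Finset.card_union_le _ _).trans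
      (Nat.add_le_add_left Finset.card_biUnion_le _)) _))
  rw [D.blockSize, Finset.card_univ, Fintype.card_fin] at hc
  have hsum : ((∑ j ∈ S.erase j0, (D.blocks j \ D.blocks j0).card : ℕ) : ℚ)
      = ((r : ℚ) - 1) * ((k : ℚ) - (μ : ℚ)) := by
    rw [Nat.cast_sum, Finset.sum_congr rfl (g := fun _ => ((k : ℚ) - (μ : ℚ)))]
    · rw [Finset.sum_const, Finset.card_erase_of_mem hj0, hSr, nsmul_eq_mul,
        Nat.cast_sub hr.le, Nat.cast_one]
    · intro j hj
      rw [Finset.mem_erase] at hj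
      have hαj : α ∈ D.blocks j := by simpa [hS] using hj.2
      have h1 := hint j j0 hj.1 ⟨α, Finset.mem_inter.mpr ⟨hαj, hα0⟩⟩
      have h2 := Finset.card_sdiff_add_card_inter (D.blocks j) (D.blocks j0)
      rw [h1, D.blockSize] at h2
      rw [eq_sub_iff_add_eq]; exact_mod_cast h2
  have hc' : (v : ℚ) ≤ ((Finset.univ.filter fun β => D.concurrence α β = 0).card : ℚ) +
      ((k : ℚ) + ((∑ j ∈ S.erase j0, (D.blocks j \ D.blocks j0).card : ℕ) : ℚ)) := by
    exact_mod_cast hc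
  rw [hsum] at hc'
  linarith

/-- Theorem 4, inequality: if every pair of distinct non-disjoint blocks of a
`(v,b,r,k)`-design `D` (with `r > 1`) meet in exactly `μ > 0` treatments, then
`η₀(D) ≥ v(v − k − (r−1)(k−μ))/2`. -/
theorem eta_zero_lower_bound (v b r k μ : ℕ) (hv : 0 < v) (hb : 0 < b) (hk : 0 < k)
    (hr : 1 < r) (hμ : 0 < μ) (D : BlockDesign v b r k)
    (hint : ∀ j j' : Fin b, j ≠ j' → (D.blocks j ∩ D.blocks j').Nonempty →
      (D.blocks j ∩ D.blocks j').card = μ) :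
    (v : ℚ) * ((v : ℚ) - (k : ℚ) - ((r : ℚ) - 1) * ((k : ℚ) - (μ : ℚ))) / 2
      ≤ (D.eta 0 : ℚ) := by
  have h := Finset.sum_le_sum fun (α : Fin v) (_ : α ∈ Finset.univ) =>
    D.zero_count hr hint α
  rw [Finset.sum_const, Finset.card_univ, Fintype.card_fin, nsmul_eq_mul, ← Nat.cast_sum,
    D.two_eta hr] at h
  push_cast at h
  linarith
end
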